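/- For every integer n ≥ 4, let Ỹ = {((s₁,x₁),(s₂,x₂)) ∈ (ℝ × D^{n−1})² : for every m ∈ ℤ, (s₂, x₂) ≠ (s₁ + m, x₁)}, the universal cover of C₂(S¹ × D^{n−1}). Then Ỹ is simply connected and its (n−1)-st homotopy group, at any basepoint, is isomorphic to a free abelian group of countably infinite rank, i.e. to the direct sum ⊕_{ℕ} ℤ. -/

import Mathlib

/-- The closed unit ball `D^m ⊆ ℝ^m`. -/
abbrev Dball (m : ℕ) : Type := {x : EuclideanSpace ℝ (Fin m) // ‖x‖ ≤ 1}

/-- The universal cover `Ỹ` of `C₂(S¹ × D^{n-1})`: the space of pairs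
`((s₁,x₁),(s₂,x₂)) ∈ (ℝ × D^{n-1})²` such that `(s₂,x₂) ≠ (s₁ + m, x₁)` for every `m ∈ ℤ`. -/
abbrev UnivCoverConf2 (n : ℕ) : Type :=
  {q : (ℝ × Dball (n - 1)) × (ℝ × Dball (n - 1)) //
    ∀ m : ℤ, q.2 ≠ (q.1.1 + (m : ℝ), q.1.2)}

namespace UC

open Topology unitInterval Set Topology.Homotopy

set_option linter.unusedSectionVars false

noncomputable section

/-- The ambient Euclidean space `ℝ^k × ℝ`. -/
abbrev E (k : ℕ) : Type := (Fin k → ℝ) × ℝ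

variable {k : ℕ} {N : Type} [Fintype N] [DecidableEq N]

/-- Complement of the punctures `P × 0`. -/
def XS (P : Set (Fin k → ℝ)) : Set (E k) := {x | x.1 ∈ P → x.2 ≠ 0}

/-- Complement of the vertical rays above the punctures. -/
def VS (P : Set (Fin k → ℝ)) : Set (E k) := {x | x.1 ∈ P → x.2 < 0}

lemma VS_sub_XS (P : Set (Fin k → ℝ)) : VS P ⊆ XS P := fun _ hx h => (hx h).ne

/-- First push down, then move linearly to `b`. -/
def contr (b : E k) (s : ℝ) (x : E k) : E k :=
  (1 - max (2 * s - 1) 0) • ((x.1, x.2 - min (2 * s) 1 * max (x.2 - b.2) 0) : E k) +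
    max (2 * s - 1) 0 • b

lemma contr_continuous (b : E k) : Continuous (fun p : ℝ × E k => contr b p.1 p.2) := by
  unfold contr; fun_prop

@[fun_prop]
lemma contr_comp_continuous {Z : Type*} [TopologicalSpace Z] (b : E k) {u : Z → ℝ} {v : Z → E k}
    (hu : Continuous u) (hv : Continuous v) : Continuous (fun z => contr b (u z) (v z)) :=
  (contr_continuous b).comp (hu.prodMk hv)

lemma contr_zero (b x : E k) : contr b 0 x = x := by
  simp [contr]

lemma contr_one (b x : E k) : contr b 1 x = b := by
  simp [contr]; norm_num

lemma contr_base (b : E k) (s : ℝ) : contr b s b = b := by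
  simp only [contr, sub_self, max_self, mul_zero, sub_zero]
  ext <;> simp <;> ring

lemma contr_mem {P : Set (Fin k → ℝ)} {b : E k} (hb : b.2 < 0) {s : ℝ} (hs0 : 0 ≤ s) (hs1 : s ≤ 1)
    {x : E k} (hx : x ∈ VS P) : contr b s x ∈ VS P := by
  intro h
  rcases le_or_gt (2 * s) 1 with h2 | h2
  · have e : max (2 * s - 1) 0 = 0 := max_eq_right (by linarith)
    have e2 : min (2 * s) 1 = 2 * s := min_eq_left h2
    simp only [contr, e, sub_zero, one_smul, zero_smul, add_zero, e2] at h ⊢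
    have := hx h
    have h3 : 0 ≤ max (x.2 - b.2) 0 := le_max_right _ _
    nlinarith [mul_nonneg hs0 h3]
  · have e : max (2 * s - 1) 0 = 2 * s - 1 := max_eq_left (by linarith)
    have e2 : min (2 * s) 1 = 1 := min_eq_right h2.le
    simp only [contr, e, e2, one_mul, Prod.snd_add, Prod.smul_snd, smul_eq_mul]
    have h3 : x.2 - b.2 ≤ max (x.2 - b.2) 0 := le_max_left _ _
    nlinarith

/-- the interior reparametrization of the cube -/
def qq (r : ℝ) (t : N → ℝ) : N → ℝ :=
  fun i => max 0 (min 1 ((1 + |r|) * (t i - 1 / 2) + 1 / 2))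

/-- collar depth -/
def ov (r : ℝ) (t : N → ℝ) : ℝ := max 0 ((1 + |r|) * (2 * ‖fun i => t i - 1 / 2‖) - 1)

@[fun_prop]
lemma qq_continuous {Z : Type*} [TopologicalSpace Z] {u : Z → ℝ} {v : Z → N → ℝ}
    (hu : Continuous u) (hv : Continuous v) : Continuous (fun z => qq (u z) (v z)) := by
  unfold qq; fun_prop

@[fun_prop]
lemma ov_continuous {Z : Type*} [TopologicalSpace Z] {u : Z → ℝ} {v : Z → N → ℝ}
    (hu : Continuous u) (hv : Continuous v) : Continuous (fun z => ov (u z) (v z)) := by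
  unfold ov; fun_prop

/-- closed cube -/
def cube (N : Type) : Set (N → ℝ) := {t | ∀ i, 0 ≤ t i ∧ t i ≤ 1}

/-- boundary of the cube -/
def bd (N : Type) : Set (N → ℝ) := {t | ∃ i, t i = 0 ∨ t i = 1}

lemma qq_mem (r : ℝ) (t : N → ℝ) : qq r t ∈ cube N := fun i =>
  ⟨le_max_left _ _, max_le zero_le_one (min_le_left _ _)⟩

lemma qq_bd (r : ℝ) {t : N → ℝ} (ht : t ∈ bd N) : qq r t ∈ bd N := by
  obtain ⟨i, hi⟩ := ht
  refine ⟨i, ?_⟩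
  have := abs_nonneg r
  rcases hi with hi | hi
  · left; simp only [qq, hi]
    apply max_eq_left
    apply (min_le_right _ _).trans; nlinarith
  · right; simp only [qq, hi]
    rw [min_eq_left (by nlinarith)]; simp

lemma qq_zero {t : N → ℝ} (ht : t ∈ cube N) : qq 0 t = t := by
  funext i
  have := ht i
  simp [qq, this.1, this.2]

lemma norm_le_half {t : N → ℝ} (ht : t ∈ cube N) : ‖fun i => t i - 1 / 2‖ ≤ 1 / 2 := by
  rw [pi_norm_le_iff_of_nonneg (by norm_num)]
  intro i
  have := ht i
  rw [Real.norm_eq_abs, abs_le]; constructor <;> linarith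

lemma norm_bd {t : N → ℝ} (ht : t ∈ cube N) (hb : t ∈ bd N) : ‖fun i => t i - 1 / 2‖ = 1 / 2 := by
  apply le_antisymm (norm_le_half ht)
  obtain ⟨i, hi⟩ := hb
  have := norm_le_pi_norm (fun i => t i - 1 / 2) i
  refine le_trans ?_ this
  rcases hi with hi | hi <;> simp [hi] <;> norm_num [abs_of_pos]

lemma ov_nonneg (r : ℝ) (t : N → ℝ) : 0 ≤ ov r t := le_max_left _ _

lemma ov_le {r : ℝ} (h0 : 0 ≤ r) (h1 : r ≤ 1) {t : N → ℝ} (ht : t ∈ cube N) : ov r t ≤ 1 := by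
  have := norm_le_half ht
  apply max_le zero_le_one
  rw [abs_of_nonneg h0]
  nlinarith

lemma ov_zero {t : N → ℝ} (ht : t ∈ cube N) : ov 0 t = 0 := by
  have := norm_le_half ht
  apply max_eq_left
  simp; linarith

lemma ov_one_bd {t : N → ℝ} (ht : t ∈ cube N) (hb : t ∈ bd N) : ov 1 t = 1 := by
  simp only [ov, norm_bd ht hb]; norm_num

/-- if the collar depth is positive then the reparametrized point is on the boundary -/
lemma qq_bd_of_ov {r : ℝ} {t : N → ℝ} (h : 0 < ov r t) : qq r t ∈ bd N := by
  have h1 : 0 < (1 + |r|) * (2 * ‖fun i => t i - 1 / 2‖) - 1 := by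
    by_contra hc
    rw [ov, max_eq_left (not_lt.mp hc)] at h
    exact lt_irrefl _ h
  have hr := abs_nonneg r
  have h2 : ∃ i, 1 / (2 * (1 + |r|)) < |t i - 1 / 2| := by
    by_contra hc
    push Not at hc
    have : ‖fun i => t i - 1 / 2‖ ≤ 1 / (2 * (1 + |r|)) := by
      rw [pi_norm_le_iff_of_nonneg (by positivity)]
      exact hc
    have h3 : (1 + |r|) * (2 * ‖fun i => t i - 1 / 2‖) ≤ (1 + |r|) * (2 * (1 / (2 * (1 + |r|)))) := by
      gcongr
    have : (1 + |r|) * (2 * (1 / (2 * (1 + |r|)))) = 1 := by field_simp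
    linarith
  obtain ⟨i, hi⟩ := h2
  refine ⟨i, ?_⟩
  rw [div_lt_iff₀ (by positivity)] at hi
  rcases abs_cases (t i - 1 / 2) with ⟨e, _⟩ | ⟨e, _⟩
  · right
    rw [e] at hi
    simp only [qq]
    rw [min_eq_left (by linarith)]; simp
  · left
    rw [e] at hi
    simp only [qq]
    apply max_eq_left
    apply (min_le_right _ _).trans; linarith

/-- partial collar -/
def col (b : E k) (r : ℝ) (F : (N → ℝ) → E k) (t : N → ℝ) : E k := contr b (ov r t) (F (qq r t))

/-- maps of pairs `(I^N, ∂I^N) → (X, V)`. -/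
structure Good (P : Set (Fin k → ℝ)) (F : (N → ℝ) → E k) : Prop where
  mem : ∀ t ∈ cube N, F t ∈ XS P
  bdm : ∀ t ∈ cube N, t ∈ bd N → F t ∈ VS P

lemma col_zero (b : E k) (F : (N → ℝ) → E k) {t : N → ℝ} (ht : t ∈ cube N) :
    col b 0 F t = F t := by
  simp [col, ov_zero ht, qq_zero ht, contr_zero]

lemma col_good {P : Set (Fin k → ℝ)} {b : E k} (hb : b.2 < 0) {r : ℝ} (h0 : 0 ≤ r) (h1 : r ≤ 1)
    {F : (N → ℝ) → E k} (hF : Good P F) : Good P (col b r F) := by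
  constructor
  · intro t ht
    rcases (ov_nonneg r t).eq_or_lt with h | h
    · rw [col, ← h, contr_zero]; exact hF.mem _ (qq_mem _ _)
    · exact VS_sub_XS P (contr_mem hb h.le (ov_le h0 h1 ht) (hF.bdm _ (qq_mem _ _) (qq_bd_of_ov h)))
  · intro t ht htb
    exact contr_mem hb (ov_nonneg _ _) (ov_le h0 h1 ht) (hF.bdm _ (qq_mem _ _) (qq_bd _ htb))

lemma col_one_bd {b : E k} (F : (N → ℝ) → E k) {t : N → ℝ} (ht : t ∈ cube N) (hb : t ∈ bd N) :
    col b 1 F t = b := by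
  rw [col, ov_one_bd ht hb, contr_one]

/-- pair-homotopy -/
def PH (P : Set (Fin k → ℝ)) (F G : (N → ℝ) → E k) : Prop :=
  ∃ H : ℝ × (N → ℝ) → E k, Continuous H ∧ (∀ s, 0 ≤ s → s ≤ 1 → Good P (fun t => H (s, t))) ∧
    (∀ t ∈ cube N, H (0, t) = F t) ∧ (∀ t ∈ cube N, H (1, t) = G t)

lemma coe_cube (t : N → I) : (fun i => (t i : ℝ)) ∈ cube N := fun i => ⟨(t i).2.1, (t i).2.2⟩

lemma coe_bd {t : N → I} (h : t ∈ Cube.boundary N) : (fun i => (t i : ℝ)) ∈ bd N := by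
  obtain ⟨i, hi⟩ := h
  exact ⟨i, by rcases hi with h | h <;> simp [h]⟩

/-- base point in the punctured space -/
def bp (P : Set (Fin k → ℝ)) (b : E k) (hb : b.2 < 0) : XS P := ⟨b, fun _ => hb.ne⟩

/-- bundled pair maps -/
structure GM (P : Set (Fin k → ℝ)) (N : Type) where
  F : (N → ℝ) → E k
  cont : Continuous F
  good : Good P F

variable {P : Set (Fin k → ℝ)} {b : E k}

/-- the generalized loop of a pair map -/
def kap (hb : b.2 < 0) (G : GM P N) : GenLoop N (XS P) (bp P b hb) :=
  ⟨⟨fun t => ⟨col b 1 G.F (fun i => (t i : ℝ)),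
    (col_good hb zero_le_one le_rfl G.good).mem _ (coe_cube t)⟩, by
      have := G.cont
      unfold col; fun_prop⟩, by
    intro t ht
    apply Subtype.ext
    exact col_one_bd _ (coe_cube t) (coe_bd ht)⟩

lemma kap_apply (hb : b.2 < 0) (G : GM P N) (t : N → I) :
    (kap hb G t : E k) = col b 1 G.F (fun i => (t i : ℝ)) := rfl

/-- class of a pair map -/
def cls (hb : b.2 < 0) (G : GM P N) : HomotopyGroup N (XS P) (bp P b hb) :=
  Quotient.mk (GenLoop.Homotopic.setoid N _) (kap hb G)

/-- the class of a loop -/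
def lc {X : Type*} [TopologicalSpace X] {x : X} (f : GenLoop N X x) : HomotopyGroup N X x :=
  Quotient.mk (GenLoop.Homotopic.setoid N _) f

lemma cls_eq_of_PH (hb : b.2 < 0) {F G : GM P N} (h : PH P F.F G.F) : cls hb F = cls hb G := by
  obtain ⟨H, hc, hg, h0, h1⟩ := h
  apply Quotient.sound
  refine ⟨⟨⟨⟨fun p => ⟨col b 1 (fun t => H (p.1, t)) (fun i => (p.2 i : ℝ)),
    (col_good hb zero_le_one le_rfl (hg _ p.1.2.1 p.1.2.2)).mem _ (coe_cube _)⟩, ?_⟩, ?_, ?_⟩, ?_⟩⟩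
  · unfold col; fun_prop
  · intro t
    apply Subtype.ext
    change col b 1 (fun t => H (0, t)) _ = col b 1 F.F _
    simp only [col, h0 _ (qq_mem _ _)]
  · intro t
    apply Subtype.ext
    change col b 1 (fun t => H (1, t)) _ = col b 1 G.F _
    simp only [col, h1 _ (qq_mem _ _)]
  · intro s t ht
    apply Subtype.ext
    change col b 1 (fun t => H (s, t)) _ = col b 1 F.F _
    rw [col_one_bd _ (coe_cube t) (coe_bd ht), col_one_bd _ (coe_cube t) (coe_bd ht)]

lemma projI_bd {t : N → ℝ} (hb : t ∈ bd N) :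
    (fun i => projIcc (0 : ℝ) 1 zero_le_one (t i)) ∈ Cube.boundary N := by
  obtain ⟨i, hi⟩ := hb
  refine ⟨i, ?_⟩
  rcases hi with h | h
  · left; simp [h]
  · right; simp [h]

/-- a loop as a pair map -/
def ofLoop (hb : b.2 < 0) (f : GenLoop N (XS P) (bp P b hb)) : GM P N where
  F := fun t => (f (fun i => projIcc (0 : ℝ) 1 zero_le_one (t i)) : E k)
  cont := by
    have : Continuous f := map_continuous f.1
    have h2 : Continuous (projIcc (0 : ℝ) 1 zero_le_one) := continuous_projIcc
    fun_prop
  good := by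
    constructor
    · intro t _
      exact (f _).2
    · intro t _ hbt
      have e := GenLoop.boundary f _ (projI_bd hbt)
      rw [e]
      intro _; exact hb

lemma cls_ofLoop (hb : b.2 < 0) (f : GenLoop N (XS P) (bp P b hb)) : cls hb (ofLoop hb f) = lc f := by
  apply Quotient.sound
  symm
  have key : ∀ r (t : N → I), 
      col b r (ofLoop hb f).F (fun i => (t i : ℝ)) = (ofLoop hb f).F (qq r (fun i => (t i : ℝ))) := by
    intro r t
    rw [col]
    rcases (ov_nonneg r (fun i => (t i : ℝ))).eq_or_lt with h | h
    · rw [← h, contr_zero]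
    · have : (ofLoop hb f).F (qq r (fun i => (t i : ℝ))) = b := by
        simp only [ofLoop]
        have e := GenLoop.boundary f _ (projI_bd (qq_bd_of_ov h))
        rw [e]; rfl
      rw [this, contr_base]
  have hqI : ∀ (t : N → I) , (fun i => projIcc (0 : ℝ) 1 zero_le_one (t i : ℝ)) = t := by
    intro t; funext i; simp
  refine ⟨⟨⟨⟨fun p => f (fun i => projIcc (0 : ℝ) 1 zero_le_one
    (qq (p.1 : ℝ) (fun i => (p.2 i : ℝ)) i)), ?_⟩, ?_, ?_⟩, ?_⟩⟩
  · have : Continuous f := map_continuous f.1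
    have h2 : Continuous (projIcc (0 : ℝ) 1 zero_le_one) := continuous_projIcc
    fun_prop
  · intro t
    change f _ = f t
    congr 1
    simp [qq_zero (coe_cube t)]
  · intro t
    apply Subtype.ext
    change _ = col b 1 (ofLoop hb f).F (fun i => (t i : ℝ))
    rw [key]; simp [ofLoop]
  · intro s t ht
    change f _ = f t
    rw [GenLoop.boundary f _ ht]
    exact GenLoop.boundary f _ (projI_bd (qq_bd _ (coe_bd ht)))

lemma exists_cls (hb : b.2 < 0) (x : HomotopyGroup N (XS P) (bp P b hb)) :
    ∃ f : GenLoop N (XS P) (bp P b hb), x = lc f := by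
  induction x using Quotient.inductionOn with
  | _ f => exact ⟨f, rfl⟩

/-- pair maps into `V` are trivial -/
lemma cls_of_VS (hb : b.2 < 0) (G : GM P N) (h : ∀ t ∈ cube N, G.F t ∈ VS P) :
    cls hb G = lc GenLoop.const := by
  rw [← cls_ofLoop]
  apply cls_eq_of_PH
  refine ⟨fun p => contr b p.1 (G.F p.2), ?_, ?_, ?_, ?_⟩
  · have := G.cont
    fun_prop
  · intro s h0 h1
    exact ⟨fun t ht => VS_sub_XS P (contr_mem hb h0 h1 (h t ht)),
      fun t ht _ => (contr_mem hb h0 h1 (h t ht))⟩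
  · intro t _; simp [contr_zero]
  · intro t _; simp [contr_one, ofLoop]; rfl

end

end UC

namespace UC

open Topology unitInterval Set Topology.Homotopy

set_option linter.unusedSectionVars false

noncomputable section

variable {k : ℕ} {N : Type} [Fintype N] [DecidableEq N]
variable {P : Set (Fin k → ℝ)} {b : E k}

lemma PH.good_right {F G : (N → ℝ) → E k} (h : PH P F G) : Good P G := by
  obtain ⟨H, _, hg, _, h1⟩ := h
  have := hg 1 zero_le_one le_rfl
  exact ⟨fun t ht => by rw [← h1 t ht]; exact this.mem t ht,
    fun t ht hb => by rw [← h1 t ht]; exact this.bdm t ht hb⟩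

lemma PH.good_left {F G : (N → ℝ) → E k} (h : PH P F G) : Good P F := by
  obtain ⟨H, _, hg, h0, _⟩ := h
  have := hg 0 le_rfl zero_le_one
  exact ⟨fun t ht => by rw [← h0 t ht]; exact this.mem t ht,
    fun t ht hb => by rw [← h0 t ht]; exact this.bdm t ht hb⟩

lemma cube_update {t : N → ℝ} (ht : t ∈ cube N) (i : N) {c : ℝ} (h0 : 0 ≤ c) (h1 : c ≤ 1) :
    Function.update t i c ∈ cube N := by
  intro j
  by_cases h : j = i
  · subst h; simp [h0, h1]
  · simp [h, ht j]

lemma bd_update_self (t : N → ℝ) (i : N) {c : ℝ} (h : c = 0 ∨ c = 1) :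
    Function.update t i c ∈ bd N := ⟨i, by simpa using h⟩

lemma bd_update {t : N → ℝ} (ht : t ∈ bd N) (i : N) {c : ℝ} (h : t i = 0 → c = 0 ∨ c = 1)
    (h' : t i = 1 → c = 0 ∨ c = 1) :
    Function.update t i c ∈ bd N := by
  obtain ⟨j, hj⟩ := ht
  by_cases e : j = i
  · subst e
    exact bd_update_self _ _ (hj.elim h h')
  · exact ⟨j, by simpa [e] using hj⟩

lemma qq_update (r : ℝ) (t : N → ℝ) (i : N) (c : ℝ) :
    qq r (Function.update t i c) =
      Function.update (qq r t) i (max 0 (min 1 ((1 + |r|) * (c - 1 / 2) + 1 / 2))) := by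
  funext j
  by_cases h : j = i
  · subst h; simp [qq]
  · simp [qq, h]

lemma qq_update_one (r : ℝ) (t : N → ℝ) (i : N) :
    qq r (Function.update t i 1) = Function.update (qq r t) i 1 := by
  rw [qq_update]; congr
  have := abs_nonneg r
  rw [min_eq_left (by nlinarith)]; simp

lemma qq_update_zero (r : ℝ) (t : N → ℝ) (i : N) :
    qq r (Function.update t i 0) = Function.update (qq r t) i 0 := by
  rw [qq_update]; congr
  have := abs_nonneg r
  apply max_eq_left
  apply (min_le_right _ _).trans; nlinarith

lemma ov_update (r : ℝ) (t : N → ℝ) (i : N) :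
    ov r (Function.update t i 1) = ov r (Function.update t i 0) := by
  have : ‖fun j => Function.update t i 1 j - 1 / 2‖ = ‖fun j => Function.update t i 0 j - 1 / 2‖ := by
    simp only [Pi.norm_def]
    congr 2
    funext j
    by_cases h : j = i
    · subst h; ext; simp; norm_num
    · simp [h]
  simp only [ov, this]

lemma update_coe (t : N → I) (i : N) (c : I) :
    (fun j => ((Function.update t i c j : I) : ℝ)) = Function.update (fun j => (t j : ℝ)) i c := by
  funext j
  by_cases h : j = i
  · subst h; simp
  · simp [h]

lemma projI_coe {t : N → ℝ} (ht : t ∈ cube N) :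
    (fun j => ((projIcc (0 : ℝ) 1 zero_le_one (t j) : I) : ℝ)) = t := by
  funext j
  have := ht j
  simp [projIcc_of_mem zero_le_one (⟨this.1, this.2⟩ : t j ∈ Icc (0:ℝ) 1)]

/-- concatenation of pair maps -/
lemma cls_trans (hb : b.2 < 0) (i : N) (G G1 G2 : GM P N)
    (hm : ∀ t ∈ cube N, G1.F (Function.update t i 1) = G2.F (Function.update t i 0))
    (hL : ∀ t ∈ cube N, t i ≤ 1 / 2 → G.F t = G1.F (Function.update t i (2 * t i)))
    (hR : ∀ t ∈ cube N, 1 / 2 < t i → G.F t = G2.F (Function.update t i (2 * t i - 1))) :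
    cls hb G = lc (GenLoop.transAt i (kap hb G1) (kap hb G2)) := by
  rw [← cls_ofLoop]
  apply cls_eq_of_PH
  have hcL := G1.cont
  have hcR := G2.cont
  refine ⟨fun p => if p.2 i ≤ 1 / 2 then col b p.1 G1.F (Function.update p.2 i (2 * p.2 i))
    else col b p.1 G2.F (Function.update p.2 i (2 * p.2 i - 1)), ?_, ?_, ?_, ?_⟩
  · refine Continuous.if_le ?_ ?_ (by fun_prop) (by fun_prop) ?_
    · unfold col; fun_prop
    · unfold col; fun_prop
    · intro p hp
      have e1 : 2 * p.2 i = 1 := by rw [hp]; norm_num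
      rw [e1, sub_self, col, col, qq_update_one, qq_update_zero, ov_update, hm _ (qq_mem _ _)]
  · intro s h0 h1
    have gL := col_good hb h0 h1 G1.good
    have gR := col_good hb h0 h1 G2.good
    constructor
    · intro t ht
      have := ht i
      simp only
      split_ifs with h
      · exact gL.mem _ (cube_update ht i (by linarith) (by linarith))
      · push Not at h
        exact gR.mem _ (cube_update ht i (by linarith) (by linarith))
    · intro t ht htb
      have := ht i
      simp only
      split_ifs with h
      · refine gL.bdm _ (cube_update ht i (by linarith) (by linarith)) (bd_update htb i ?_ ?_)
        · intro h; simp [h]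
        · intro h; linarith
      · push Not at h
        refine gR.bdm _ (cube_update ht i (by linarith) (by linarith)) (bd_update htb i ?_ ?_)
        · intro h; linarith
        · intro h; rw [h]; norm_num
  · intro t ht
    have := ht i
    simp only
    split_ifs with h
    · rw [col_zero _ _ (cube_update ht i (by linarith) (by linarith)), hL t ht h]
    · push Not at h
      rw [col_zero _ _ (cube_update ht i (by linarith) (by linarith)), hR t ht h]
  · intro t ht
    have hi := ht i
    have e := projI_coe ht
    simp only [ofLoop, GenLoop.transAt, GenLoop.coe_copy]
    have ei := congrFun e i
    rw [ei]
    split_ifs with h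
    · rw [kap_apply, update_coe, e, projIcc_of_mem zero_le_one
        (⟨by linarith, by linarith⟩ : 2 * t i ∈ Icc (0:ℝ) 1)]
    · push Not at h
      rw [kap_apply, update_coe, e, projIcc_of_mem zero_le_one
        (⟨by linarith, by linarith⟩ : 2 * t i - 1 ∈ Icc (0:ℝ) 1)]

lemma lc_mul [Nonempty N] {X : Type*} [TopologicalSpace X] {x : X} (i : N) (f g : GenLoop N X x) :
    lc (GenLoop.transAt i f g) = lc g * lc f :=
  (HomotopyGroup.mul_spec (i := i) (p := g) (q := f)).symm

lemma lc_inv [Nonempty N] {X : Type*} [TopologicalSpace X] {x : X} (i : N) (f : GenLoop N X x) :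
    lc (GenLoop.symmAt i f) = (lc f)⁻¹ :=
  (HomotopyGroup.inv_spec (i := i) (p := f)).symm

lemma lc_one [Nonempty N] {X : Type*} [TopologicalSpace X] {x : X} :
    lc (GenLoop.const : GenLoop N X x) = 1 := HomotopyGroup.one_def.symm

/-- reparametrize one coordinate -/
lemma PH_reparam {F : (N → ℝ) → E k} (hc : Continuous F) (hF : Good P F) (i : N) {r : ℝ → ℝ}
    (hr : Continuous r) (h0 : r 0 = 0) (h1 : r 1 = 1) (hI : ∀ x, 0 ≤ x → x ≤ 1 → 0 ≤ r x ∧ r x ≤ 1) :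
    PH P F (fun t => F (Function.update t i (r (t i)))) := by
  refine ⟨fun p => F (Function.update p.2 i ((1 - p.1) * p.2 i + p.1 * r (p.2 i))), by fun_prop,
    ?_, ?_, ?_⟩
  · intro s hs0 hs1
    have key : ∀ t ∈ cube N, 0 ≤ (1 - s) * t i + s * r (t i) ∧ (1 - s) * t i + s * r (t i) ≤ 1 := by
      intro t ht
      have h2 := ht i
      have h3 := hI _ h2.1 h2.2
      constructor <;> nlinarith
    constructor
    · intro t ht
      exact hF.mem _ (cube_update ht i (key t ht).1 (key t ht).2)
    · intro t ht htb
      refine hF.bdm _ (cube_update ht i (key t ht).1 (key t ht).2) (bd_update htb i ?_ ?_)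
      · intro h; left; simp [h, h0]
      · intro h; right; simp [h, h1]
  · intro t _; simp
  · intro t _; simp

/-- cutting a pair map along a wall -/
lemma cls_cut [Nonempty N] (hb : b.2 < 0) (i : N) (G G1 G2 : GM P N) {a : ℝ} (ha0 : 0 ≤ a)
    (ha1 : a ≤ 1)
    (hL : ∀ t ∈ cube N, G1.F t = G.F (Function.update t i (a * t i)))
    (hR : ∀ t ∈ cube N, G2.F t = G.F (Function.update t i (a + (1 - a) * t i))) :
    cls hb G = cls hb G2 * cls hb G1 := by
  let r : ℝ → ℝ := fun x => 2 * a * min x (1 / 2) + 2 * (1 - a) * max (x - 1 / 2) 0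
  have hr : Continuous r := by fun_prop
  have r1 : ∀ x ≤ (1 / 2 : ℝ), r x = 2 * a * x := by
    intro x hx; simp only [r]; rw [min_eq_left hx, max_eq_right (by linarith)]; ring
  have r2 : ∀ x, (1 / 2 : ℝ) ≤ x → r x = a + (1 - a) * (2 * x - 1) := by
    intro x hx; simp only [r]; rw [min_eq_right hx, max_eq_left (by linarith)]; ring
  have hI : ∀ x, 0 ≤ x → x ≤ 1 → 0 ≤ r x ∧ r x ≤ 1 := by
    intro x h0 h1
    rcases le_total x (1 / 2) with h | h
    · rw [r1 x h]; constructor <;> nlinarith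
    · rw [r2 x h]; constructor <;> nlinarith
  have ph := PH_reparam (P := P) G.cont G.good i hr (by rw [r1 0 (by norm_num)]; ring)
    (by rw [r2 1 (by norm_num)]; ring) hI
  let G' : GM P N := ⟨fun t => G.F (Function.update t i (r (t i))), by
      have := G.cont
      fun_prop, by
      exact ph.good_right⟩
  rw [cls_eq_of_PH hb (G := G') ph, cls_trans hb i G' G1 G2 ?_ ?_ ?_, lc_mul]; · rfl
  · intro t ht
    rw [hL _ (cube_update ht i zero_le_one le_rfl), hR _ (cube_update ht i le_rfl zero_le_one)]
    simp
  · intro t ht h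
    have := ht i
    rw [hL _ (cube_update ht i (by linarith) (by linarith))]
    simp only [G', r1 _ h]
    simp; ring_nf
  · intro t ht h
    have := ht i
    rw [hR _ (cube_update ht i (by linarith) (by linarith))]
    simp only [G', r2 _ h.le]
    simp

/-- reflection inverts the class -/
lemma cls_refl [Nonempty N] (hb : b.2 < 0) (i : N) (G G' : GM P N)
    (h : ∀ t ∈ cube N, G'.F t = G.F (Function.update t i (1 - t i))) :
    cls hb G' = (cls hb G)⁻¹ := by
  rw [cls, cls]
  change lc _ = (lc _)⁻¹
  rw [← lc_inv i]
  congr 1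
  ext1 t
  apply Subtype.ext
  simp only [GenLoop.symmAt, GenLoop.coe_copy, kap_apply]
  have e1 : (fun j => ((if j = i then unitInterval.symm (t i) else t j : I) : ℝ)) =
      Function.update (fun j => (t j : ℝ)) i (1 - (t i : ℝ)) := by
    funext j
    by_cases h : j = i
    · subst h; simp
    · simp [h]
  rw [e1, col, col, h _ (qq_mem _ _), qq_update]
  congr 1
  · simp only [ov]
    congr 4
    simp only [Pi.norm_def]
    congr 2
    funext j
    by_cases h : j = i
    · subst h
      ext
      simp only [Function.update_self, coe_nnnorm, Real.norm_eq_abs]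
      rw [← abs_neg]; congr 1; ring
    · simp [h]
  · congr 2
    simp only [qq]
    have : (1 + |(1 : ℝ)|) * (1 - (t i : ℝ) - 1 / 2) + 1 / 2 =
      1 - ((1 + |(1 : ℝ)|) * ((t i : ℝ) - 1 / 2) + 1 / 2) := by ring
    rw [this]
    generalize (1 + |(1 : ℝ)|) * ((t i : ℝ) - 1 / 2) + 1 / 2 = x
    rcases le_total x 0 with h0 | h0
    · rw [min_eq_right (by linarith : x ≤ 1), max_eq_left h0, min_eq_left (by linarith)]; simp
    rcases le_total x 1 with h1 | h1
    · rw [min_eq_right h1, max_eq_right h0, min_eq_right (by linarith), max_eq_right (by linarith)]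
    · rw [min_eq_left h1, max_eq_right zero_le_one, min_eq_right (by linarith),
        max_eq_left (by linarith)]; simp

end

end UC

namespace UC

open Topology unitInterval Set Topology.Homotopy

set_option linter.unusedSectionVars false

noncomputable section

variable {k : ℕ} {N : Type} [Fintype N] [DecidableEq N]
variable {P : Set (Fin k → ℝ)} {b : E k}

lemma isCompact_cube : IsCompact (cube N) := by
  have : cube N = Set.pi univ (fun _ => Icc (0:ℝ) 1) := by
    ext t; simp only [cube, mem_setOf_eq, mem_pi, mem_univ, forall_true_left, mem_Icc]
  rw [this]
  exact isCompact_univ_pi (fun _ => isCompact_Icc)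

lemma isOpen_XS (hP : IsClosed P) : IsOpen (XS P) := by
  have : XS P = (P ×ˢ {(0:ℝ)})ᶜ := by
    ext x; simp [XS]
  rw [this]
  exact (hP.prod isClosed_singleton).isOpen_compl

/-- straight line homotopy -/
lemma PH_line {F G : (N → ℝ) → E k} (hF : Continuous F) (hG : Continuous G)
    (h : ∀ s : ℝ, 0 ≤ s → s ≤ 1 → Good P (fun t => F t + s • (G t - F t))) : PH P F G :=
  ⟨fun p => F p.2 + p.1 • (G p.2 - F p.2), by fun_prop, h, by simp, by simp⟩

/-- smooth approximation -/
lemma exists_smooth (hP : IsClosed P) (hb : b.2 < 0) (f : GenLoop N (XS P) (bp P b hb)) :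
    ∃ G : GM P N, ContDiff ℝ 1 G.F ∧ cls hb G = lc f ∧ ∀ t ∈ cube N, t ∈ bd N → (G.F t).2 < 0 := by
  set G0 := ofLoop hb f with hG0
  have hK : IsCompact (G0.F '' cube N) := isCompact_cube.image G0.cont
  obtain ⟨δ, hδ, hsub⟩ := hK.exists_thickening_subset_open (isOpen_XS hP)
    (by rintro _ ⟨t, ht, rfl⟩; exact G0.good.mem t ht)
  obtain ⟨g, hg, happ, -⟩ := Continuous.exists_contDiff_approx (n := 1) G0.cont
    (ε := fun _ => min δ (-b.2)) continuous_const (fun _ => lt_min hδ (by linarith))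
  have hdist : ∀ t (s : ℝ), 0 ≤ s → s ≤ 1 →
      dist (G0.F t + s • (g t - G0.F t)) (G0.F t) < min δ (-b.2) := by
    intro t s h0 h1
    rw [dist_eq_norm, add_sub_cancel_left, norm_smul, Real.norm_eq_abs, abs_of_nonneg h0]
    have := happ t
    rw [dist_eq_norm] at this
    have h2 := norm_nonneg (g t - G0.F t)
    nlinarith
  have hneg : ∀ t ∈ bd N, ∀ s : ℝ, 0 ≤ s → s ≤ 1 → (G0.F t + s • (g t - G0.F t)).2 < 0 := by
    intro t ht s h0 h1
    have e : G0.F t = b := by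
      have := GenLoop.boundary f _ (projI_bd ht)
      simp only [hG0, ofLoop, this]; rfl
    have h2 := (hdist t s h0 h1).trans_le (min_le_right _ _)
    rw [dist_eq_norm] at h2
    have h3 := (norm_snd_le _).trans_lt h2
    rw [Real.norm_eq_abs, abs_lt] at h3
    have h4 := h3.2
    rw [Prod.snd_sub] at h4
    have : (G0.F t).2 = b.2 := by rw [e]
    linarith
  have ph : PH P G0.F g := by
    apply PH_line G0.cont hg.continuous
    intro s h0 h1
    constructor
    · intro t ht
      apply hsub
      exact Metric.mem_thickening_iff.2 ⟨_, ⟨t, ht, rfl⟩, (hdist t s h0 h1).trans_le (min_le_left _ _)⟩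
    · intro t ht htb _
      exact hneg t htb s h0 h1
  refine ⟨⟨g, hg.continuous, ph.good_right⟩, hg, ?_, ?_⟩
  · rw [← cls_ofLoop]
    exact (cls_eq_of_PH hb (F := G0) (G := ⟨g, hg.continuous, ph.good_right⟩) ph).symm
  · intro t _ htb
    have := hneg t htb 1 zero_le_one le_rfl
    simpa using this

/-- transversality by Sard -/
lemma exists_regular (hP : IsClosed P) (hPc : P.Countable) (hb : b.2 < 0)
    (f : GenLoop N (XS P) (bp P b hb)) (L : (Fin k → ℝ) →L[ℝ] (N → ℝ)) :
    ∃ G : GM P N, ContDiff ℝ 1 G.F ∧ cls hb G = lc f ∧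
      ∀ u, (G.F (L u)).1 ∈ P → 0 < (G.F (L u)).2 →
        ∃ A : (Fin k → ℝ) →L[ℝ] (Fin k → ℝ), HasFDerivAt (fun u => (G.F (L u)).1) A u ∧ A.det ≠ 0 := by
  obtain ⟨G0, hG0, hcls, hneg⟩ := exists_smooth hP hb f
  set g : (Fin k → ℝ) → E k := fun u => G0.F (L u) with hgdef
  have hg : ContDiff ℝ 1 g := hG0.comp L.contDiff
  have hgd : ∀ u, HasFDerivAt g (fderiv ℝ g u) u := fun u =>
    (hg.differentiable (by norm_num) u).hasFDerivAt
  let y' := fun u => (ContinuousLinearMap.fst ℝ (Fin k → ℝ) ℝ).comp (fderiv ℝ g u)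
  let z' := fun u => (ContinuousLinearMap.snd ℝ (Fin k → ℝ) ℝ).comp (fderiv ℝ g u)
  have hy : ∀ u, HasFDerivAt (fun u => (g u).1) (y' u) u := fun u => (hgd u).fst
  have hz : ∀ u, HasFDerivAt (fun u => (g u).2) (z' u) u := fun u => (hgd u).snd
  let Q : (Fin k → ℝ) → (Fin k → ℝ) → (Fin k → ℝ) := fun p u => ((g u).2)⁻¹ • (p - (g u).1)
  let Q' := fun p u => ((g u).2)⁻¹ • (-(y' u)) + ((-((g u).2 ^ 2)⁻¹) • z' u).smulRight (p - (g u).1)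
  have hQ : ∀ p u, (g u).2 ≠ 0 → HasFDerivAt (Q p) (Q' p u) u := by
    intro p u h0
    exact ((hasDerivAt_inv h0).comp_hasFDerivAt u (hz u)).smul ((hy u).const_sub p)
  let S := fun p => {u | 0 < (g u).2 ∧ (Q' p u).det = 0}
  have hS : ∀ p, MeasureTheory.volume (Q p '' S p) = 0 := by
    intro p
    apply MeasureTheory.addHaar_image_eq_zero_of_det_fderivWithin_eq_zero (f' := Q' p)
    · intro u hu
      exact (hQ p u hu.1.ne').hasFDerivWithinAt
    · intro u hu; exact hu.2
  have hnull : MeasureTheory.volume (⋃ p ∈ P, Q p '' S p) = 0 :=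
    (MeasureTheory.measure_biUnion_null_iff hPc).2 (fun p _ => hS p)
  obtain ⟨w, hw⟩ : ∃ w, w ∉ ⋃ p ∈ P, Q p '' S p := by
    by_contra hc
    push Not at hc
    have : (⋃ p ∈ P, Q p '' S p) = univ := eq_univ_of_forall hc
    rw [this] at hnull
    have h2 : (0 : ENNReal) < MeasureTheory.volume (univ : Set (Fin k → ℝ)) :=
      isOpen_univ.measure_pos _ ⟨0, trivial⟩
    exact h2.ne' hnull
  let F : (N → ℝ) → E k := fun t => ((G0.F t).1 + (G0.F t).2 • w, (G0.F t).2)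
  have hFc : ContDiff ℝ 1 F := by
    have h1 := hG0.fst
    have h2 := hG0.snd
    exact (h1.add (h2.smul contDiff_const)).prodMk h2
  have hc0 := G0.cont
  have ph : PH P G0.F F := by
    refine ⟨fun q => ((G0.F q.2).1 + (q.1 * (G0.F q.2).2) • w, (G0.F q.2).2), by fun_prop, ?_, ?_, ?_⟩
    · intro s _ _
      constructor
      · intro t ht h h0
        simp only at h h0
        rw [h0, mul_zero, zero_smul, add_zero] at h
        exact G0.good.mem t ht h h0
      · intro t ht htb _
        exact hneg t ht htb
    · intro t _; simp
    · intro t _; simp [F]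
  refine ⟨⟨F, hFc.continuous, ph.good_right⟩, hFc, ?_, ?_⟩
  · rw [← hcls]
    exact (cls_eq_of_PH hb (F := G0) (G := ⟨F, hFc.continuous, ph.good_right⟩) ph).symm
  · intro u hP' hpos
    set p := (F (L u)).1 with hp
    have hpos' : 0 < (g u).2 := hpos
    have epw : p - (g u).1 = (g u).2 • w := by
      simp [hp, F, hgdef]
    have hQw : Q p u = w := by
      simp only [Q, epw, smul_smul, inv_mul_cancel₀ hpos'.ne', one_smul]
    have hdet : (Q' p u).det ≠ 0 := by
      intro h0
      apply hw
      simp only [mem_iUnion]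
      exact ⟨p, hP', u, ⟨hpos', h0⟩, hQw⟩
    refine ⟨y' u + (z' u).smulRight w, ?_, ?_⟩
    · exact (hy u).add ((hz u).smul_const w)
    · have e : Q' p u = (-((g u).2)⁻¹) • (y' u + (z' u).smulRight w) := by
        ext v i
        simp only [Q', epw]
        simp
        field_simp
      intro h0
      apply hdet
      rw [e, ContinuousLinearMap.det, ContinuousLinearMap.toLinearMap_smul, LinearMap.det_smul]
      rw [ContinuousLinearMap.det] at h0
      rw [h0, mul_zero]

/-- low-dimensional homotopy groups vanish -/
lemma lc_trivial (hP : IsClosed P) (hPc : P.Countable) (hb : b.2 < 0) (hN : Fintype.card N < k)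
    (f : GenLoop N (XS P) (bp P b hb)) : lc f = lc GenLoop.const := by
  obtain ⟨L, hL⟩ : ∃ L : (Fin k → ℝ) →ₗ[ℝ] (N → ℝ), Function.Surjective L := by
    have : Nonempty (N ↪ Fin k) := by
      rw [Function.Embedding.nonempty_iff_card_le]; simpa using hN.le
    obtain ⟨e⟩ := this
    refine ⟨LinearMap.funLeft ℝ ℝ e, LinearMap.funLeft_surjective_of_injective _ _ _ e.injective⟩
  let L' : (Fin k → ℝ) →L[ℝ] (N → ℝ) := LinearMap.toContinuousLinearMap L
  obtain ⟨G, hG, hcls, hreg⟩ := exists_regular hP hPc hb f L'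
  rw [← hcls]
  apply cls_of_VS
  intro t ht hP'
  by_contra hc
  push Not at hc
  have hpos : 0 < (G.F t).2 := lt_of_le_of_ne hc (G.good.mem t ht hP').symm
  obtain ⟨u, hu⟩ := hL t
  have hu' : L' u = t := hu
  rw [← hu'] at hP' hpos
  obtain ⟨A, hA, hdet⟩ := hreg u hP' hpos
  have hB := ((hG.fst.differentiable (by norm_num) (L' u)).hasFDerivAt).comp u (L'.hasFDerivAt (x := u))
  have e := hA.unique hB
  have hker : ∃ v, v ≠ 0 ∧ L v = 0 := by
    have : ¬ Function.Injective L := by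
      intro hi
      have := LinearMap.finrank_le_finrank_of_injective hi
      simp at this; omega
    rw [← LinearMap.ker_eq_bot, Submodule.eq_bot_iff] at this
    push Not at this
    obtain ⟨v, h1, h2⟩ := this
    exact ⟨v, h2, h1⟩
  obtain ⟨v, hv, hv0⟩ := hker
  apply hv
  have hA0 : A v = 0 := by
    rw [e]
    have : L' v = 0 := hv0
    simp [this]
  rw [ContinuousLinearMap.det] at hdet
  have hinj : LinearMap.ker (A : (Fin k → ℝ) →ₗ[ℝ] (Fin k → ℝ)) = ⊥ := by
    by_contra hk
    exact hdet (LinearMap.det_eq_zero_iff_ker_ne_bot.2 hk)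
  have : v ∈ LinearMap.ker (A : (Fin k → ℝ) →ₗ[ℝ] (Fin k → ℝ)) := hA0
  rw [hinj] at this
  simpa using this

end

end UC

namespace UC

open Topology unitInterval Set Topology.Homotopy Matrix

set_option linter.unusedSectionVars false

noncomputable section

variable {k : ℕ}
variable {P : Set (Fin k → ℝ)} {b : E k}

/-- radial compression into the unit ball -/
def gg (w : Fin k → ℝ) : Fin k → ℝ := (1 + ‖w‖)⁻¹ • w

@[fun_prop]
lemma gg_continuous {Z : Type*} [TopologicalSpace Z] {v : Z → Fin k → ℝ}
    (hv : Continuous v) : Continuous (fun z => gg (v z)) := by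
  unfold gg
  have h1 : Continuous (fun z => 1 + ‖v z‖) := by fun_prop
  exact (h1.inv₀ (fun z => by positivity)).smul hv

lemma gg_norm (w : Fin k → ℝ) : ‖gg w‖ < 1 := by
  have := norm_nonneg w
  rw [gg, norm_smul, norm_inv, Real.norm_eq_abs, abs_of_pos (by positivity), inv_mul_lt_iff₀ (by positivity)]
  linarith

lemma gg_eq_zero {w : Fin k → ℝ} (h : gg w = 0) : w = 0 := by
  have := norm_nonneg w
  rw [gg, smul_eq_zero] at h
  rcases h with h | h
  · have : (1 + ‖w‖) ≠ 0 := by positivity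
    exact absurd h (inv_ne_zero this)
  · exact h

/-- separated punctures -/
def Sep (P : Set (Fin k → ℝ)) : Prop := ∀ p ∈ P, ∀ q ∈ P, ‖q - p‖ < 1 → q = p

/-- centered coordinates -/
def cen (t : Fin k → ℝ) : Fin k → ℝ := fun i => 2 * t i - 1

@[fun_prop]
lemma cen_continuous {Z : Type*} [TopologicalSpace Z] {v : Z → Fin k → ℝ}
    (hv : Continuous v) : Continuous (fun z => cen (v z)) := by
  unfold cen; fun_prop

lemma cen_ne {t : Fin k → ℝ} (h : t ∈ bd (Fin k)) : cen t ≠ 0 := by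
  intro h0
  obtain ⟨i, hi⟩ := h
  have := congrFun h0 i
  simp only [cen, Pi.zero_apply] at this
  rcases hi with h | h <;> rw [h] at this <;> norm_num at this

/-- standard map -/
def stdF (p : Fin k → ℝ) (B : Matrix (Fin k) (Fin k) ℝ) (t : Fin k → ℝ) : E k :=
  (p + gg (B *ᵥ cen t), 1)

lemma stdF_good (hP : Sep P) {p : Fin k → ℝ} (hp : p ∈ P) {B : Matrix (Fin k) (Fin k) ℝ}
    (hB : B.det ≠ 0) : Good P (stdF p B) := by
  constructor
  · intro t _ _
    simp [stdF]
  · intro t _ htb h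
    exfalso
    have e := hP p hp _ h (by simpa [stdF] using gg_norm _)
    simp only [stdF, add_eq_left] at e
    have e2 := gg_eq_zero e
    exact hB (exists_mulVec_eq_zero_iff.1 ⟨_, cen_ne htb, e2⟩)

@[fun_prop]
lemma mulVec_cont {Z : Type*} [TopologicalSpace Z] {B : Z → Matrix (Fin k) (Fin k) ℝ}
    {v : Z → Fin k → ℝ} (hB : Continuous B)
    (hv : Continuous v) : Continuous (fun z => (B z) *ᵥ (v z)) := hB.matrix_mulVec hv

/-- bundled standard map -/
def stdG (hP : Sep P) {p : Fin k → ℝ} (hp : p ∈ P) (B : Matrix (Fin k) (Fin k) ℝ)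
    (hB : B.det ≠ 0) : GM P (Fin k) where
  F := stdF p B
  cont := by
    unfold stdF
    fun_prop
  good := stdF_good hP hp hB

lemma std_path (hb : b.2 < 0) (hP : Sep P) {p : Fin k → ℝ} (hp : p ∈ P)
    {B B' : Matrix (Fin k) (Fin k) ℝ} (hB : B.det ≠ 0) (hB' : B'.det ≠ 0)
    (M : ℝ → Matrix (Fin k) (Fin k) ℝ) (hM : Continuous M)
    (h : ∀ s, 0 ≤ s → s ≤ 1 → (M s).det ≠ 0) (h0 : M 0 = B) (h1 : M 1 = B') :
    cls hb (stdG hP hp B hB) = cls hb (stdG hP hp B' hB') := by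
  apply cls_eq_of_PH
  refine ⟨fun q => stdF p (M q.1) q.2, ?_, ?_, ?_, ?_⟩
  · unfold stdF; fun_prop
  · intro s hs0 hs1
    have := stdF_good hP hp (h s hs0 hs1)
    exact this
  · intro t _
    change stdF p (M 0) t = stdF p B t
    rw [h0]
  · intro t _
    change stdF p (M 1) t = stdF p B' t
    rw [h1]

variable [Nonempty (Fin k)]

lemma std_flip (hb : b.2 < 0) (hP : Sep P) {p : Fin k → ℝ} (hp : p ∈ P)
    {B : Matrix (Fin k) (Fin k) ℝ} (hB : B.det ≠ 0) (i : Fin k)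
    (hB' : (B * diagonal (fun j => if j = i then -1 else 1)).det ≠ 0) :
    cls hb (stdG hP hp _ hB') = (cls hb (stdG hP hp B hB))⁻¹ := by
  apply cls_refl hb i
  intro t _
  simp only [stdG, stdF]
  congr 3
  rw [← mulVec_mulVec]
  congr 1
  funext j
  rw [mulVec_diagonal]
  by_cases h : j = i
  · subst h; simp [cen]; ring
  · simp [cen, h]

lemma std_ind (hb : b.2 < 0) (hP : Sep P) {p : Fin k → ℝ} (hp : p ∈ P)
    {M : Matrix (Fin k) (Fin k) ℝ} (hM : M.det ≠ 0) :
    ∀ (B : Matrix (Fin k) (Fin k) ℝ) (hB : B.det ≠ 0) (hB' : (B * M).det ≠ 0),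
      cls hb (stdG hP hp (B * M) hB') = cls hb (stdG hP hp B hB) ∨
      cls hb (stdG hP hp (B * M) hB') = (cls hb (stdG hP hp B hB))⁻¹ := by
  refine Matrix.diagonal_transvection_induction_of_det_ne_zero (fun M =>
    ∀ (B : Matrix (Fin k) (Fin k) ℝ) (hB : B.det ≠ 0) (hB' : (B * M).det ≠ 0),
      cls hb (stdG hP hp (B * M) hB') = cls hb (stdG hP hp B hB) ∨
      cls hb (stdG hP hp (B * M) hB') = (cls hb (stdG hP hp B hB))⁻¹) M hM ?_ ?_ ?_
  · intro D hD B hB hB'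
    have hDi : ∀ i, D i ≠ 0 := by
      intro i h0
      apply hD
      rw [det_diagonal]
      exact Finset.prod_eq_zero (Finset.mem_univ i) h0
    let sg : Finset (Fin k) → Fin k → ℝ := fun S i => if i ∈ S then -1 else 1
    have hsg : ∀ S, (B * diagonal (sg S)).det ≠ 0 := by
      intro S
      rw [det_mul, det_diagonal]
      refine mul_ne_zero hB (Finset.prod_ne_zero_iff.2 (fun i _ => ?_))
      simp only [sg]; split_ifs <;> norm_num
    have hS : ∀ S, cls hb (stdG hP hp _ (hsg S)) = cls hb (stdG hP hp B hB) ∨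
      cls hb (stdG hP hp _ (hsg S)) = (cls hb (stdG hP hp B hB))⁻¹ := by
      intro S
      induction S using Finset.induction_on with
      | empty =>
        left
        congr 2
        have : sg ∅ = 1 := by funext i; simp [sg]
        rw [this, Matrix.diagonal_one', mul_one]
      | insert i S hi ih =>
        have e : B * diagonal (sg (insert i S)) =
            (B * diagonal (sg S)) * diagonal (fun j => if j = i then -1 else 1) := by
          rw [mul_assoc, diagonal_mul_diagonal]
          congr 2
          funext j
          by_cases h : j = i
          · subst h; simp [sg, hi]
          · simp [sg, h]
        have := std_flip hb hP hp (hsg S) i (by rw [← e]; exact hsg _)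
        have e2 : cls hb (stdG hP hp _ (hsg (insert i S))) = (cls hb (stdG hP hp _ (hsg S)))⁻¹ := by
          rw [← this]; congr 2
        rw [e2]
        rcases ih with ih | ih
        · right; rw [ih]
        · left; rw [ih, inv_inv]
    let S := Finset.univ.filter (fun i => D i < 0)
    have : cls hb (stdG hP hp (B * diagonal D) hB') = cls hb (stdG hP hp _ (hsg S)) := by
      apply std_path hb hP hp hB' (hsg S)
        (fun s => B * diagonal (fun i => (1 - s) * D i + s * sg S i))
      · refine Continuous.matrix_mul continuous_const (Continuous.matrix_diagonal ?_)
        fun_prop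
      · intro s h0 h1
        rw [det_mul, det_diagonal]
        refine mul_ne_zero hB (Finset.prod_ne_zero_iff.2 (fun i _ => ?_))
        rcases lt_or_gt_of_ne (hDi i) with h | h
        · have : sg S i = -1 := by simp [sg, S, h]
          rw [this]
          apply ne_of_lt
          rcases h0.eq_or_lt with e | e
          · rw [← e]; simpa using h
          · nlinarith
        · have : sg S i = 1 := by simp [sg, S, h.le]
          rw [this]
          apply ne_of_gt
          rcases h0.eq_or_lt with e | e
          · rw [← e]; simpa using h
          · nlinarith
      · simp
      · simp
    rw [this]
    exact hS S
  · intro t B hB hB'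
    left
    symm
    apply std_path hb hP hp hB hB' (fun s => B * transvection t.i t.j (s * t.c))
    · simp only [transvection]
      refine Continuous.matrix_mul continuous_const (continuous_const.add ?_)
      refine continuous_matrix (fun i j => ?_)
      simp only [single, of_apply]
      split_ifs <;> fun_prop
    · intro s _ _
      rw [det_mul, det_transvection_of_ne _ _ t.hij, mul_one]; exact hB
    · simp
    · simp [TransvectionStruct.toMatrix]
  · intro A C hA hC ihA ihC B hB hB'
    have hBA : (B * A).det ≠ 0 := by rw [det_mul]; exact mul_ne_zero hB hA
    have h1 := ihA B hB hBA
    have h2 := ihC (B * A) hBA (by rw [det_mul]; exact mul_ne_zero hBA hC)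
    have e : cls hb (stdG hP hp (B * (A * C)) hB') = cls hb (stdG hP hp (B * A * C)
      (by rw [det_mul]; exact mul_ne_zero hBA hC)) := by
      congr 2; rw [mul_assoc]
    rw [e]
    rcases h1 with h1 | h1 <;> rcases h2 with h2 | h2 <;> rw [h2, h1] <;> simp

/-- the generator at `p` -/
def gen (hb : b.2 < 0) (hP : Sep P) {p : Fin k → ℝ} (hp : p ∈ P) :
    HomotopyGroup (Fin k) (XS P) (bp P b hb) := cls hb (stdG hP hp 1 (by simp))

lemma std_eq_gen (hb : b.2 < 0) (hP : Sep P) {p : Fin k → ℝ} (hp : p ∈ P)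
    {B : Matrix (Fin k) (Fin k) ℝ} (hB : B.det ≠ 0) :
    cls hb (stdG hP hp B hB) = gen hb hP hp ∨ cls hb (stdG hP hp B hB) = (gen hb hP hp)⁻¹ := by
  have := std_ind hb hP hp hB 1 (by simp) (by simpa using hB)
  have e : cls hb (stdG hP hp (1 * B) (by simpa using hB)) = cls hb (stdG hP hp B hB) := by
    congr 2; rw [one_mul]
  rw [e] at this
  exact this

end

end UC

namespace UC

open Topology unitInterval Set Topology.Homotopy Matrix

set_option linter.unusedSectionVars false

noncomputable section

variable {k : ℕ}
variable {P : Set (Fin k → ℝ)} {b : E k}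

/-- points where the map hits the upper ray -/
def Hs (P : Set (Fin k → ℝ)) (F : (Fin k → ℝ) → E k) : Set (Fin k → ℝ) :=
  {x | x ∈ cube (Fin k) ∧ (F x).1 ∈ P ∧ 0 < (F x).2}

/-- affine box map -/
def bxm (lo hi t : Fin k → ℝ) : Fin k → ℝ := fun i => lo i + t i * (hi i - lo i)

lemma bxm_mem {lo hi t : Fin k → ℝ} (h : ∀ i, lo i ≤ hi i) (ht : t ∈ cube (Fin k)) (i : Fin k) :
    lo i ≤ bxm lo hi t i ∧ bxm lo hi t i ≤ hi i := by
  have h1 := h i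
  have h2 := ht i
  unfold bxm
  constructor <;> nlinarith

@[fun_prop]
lemma bxm_cont {Z : Type*} [TopologicalSpace Z] {u v w : Z → Fin k → ℝ} (hu : Continuous u)
    (hv : Continuous v) (hw : Continuous w) : Continuous (fun z => bxm (u z) (v z) (w z)) := by
  unfold bxm; fun_prop

lemma not_hit {F : (Fin k → ℝ) → E k} (hF : Good P F) {x : Fin k → ℝ} (hx : x ∈ cube (Fin k))
    (h : x ∉ Hs P F) : F x ∈ VS P := by
  intro hp
  by_contra hc
  push Not at hc
  exact h ⟨hx, hp, lt_of_le_of_ne hc (hF.mem x hx hp).symm⟩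

/-- admissible boxes -/
structure Box (P : Set (Fin k → ℝ)) (F : (Fin k → ℝ) → E k) (lo hi : Fin k → ℝ) : Prop where
  l0 : ∀ i, 0 ≤ lo i
  h1 : ∀ i, hi i ≤ 1
  le : ∀ i, lo i ≤ hi i
  int : ∀ x ∈ Hs P F, (∀ i, lo i ≤ x i ∧ x i ≤ hi i) → ∀ i, lo i < x i ∧ x i < hi i

lemma Box.cube {F : (Fin k → ℝ) → E k} {lo hi : Fin k → ℝ} (h : Box P F lo hi) {t : Fin k → ℝ}
    (ht : t ∈ cube (Fin k)) : bxm lo hi t ∈ cube (Fin k) := by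
  intro i
  have := bxm_mem h.le ht i
  exact ⟨(h.l0 i).trans this.1, this.2.trans (h.h1 i)⟩

lemma Box.good {F : (Fin k → ℝ) → E k} (hF : Good P F) {lo hi : Fin k → ℝ} (h : Box P F lo hi) :
    Good P (fun t => F (bxm lo hi t)) := by
  constructor
  · intro t ht
    exact hF.mem _ (h.cube ht)
  · intro t ht htb
    apply not_hit hF (h.cube ht)
    intro hh
    have := h.int _ hh (fun i => bxm_mem h.le ht i)
    obtain ⟨i, hi⟩ := htb
    have h2 := this i
    simp only [bxm] at h2
    rcases hi with e | e <;> rw [e] at h2 <;> linarith [h2.1, h2.2]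

/-- bundled box restriction -/
def bxG (G : GM P (Fin k)) {lo hi : Fin k → ℝ} (h : Box P G.F lo hi) : GM P (Fin k) where
  F := fun t => G.F (bxm lo hi t)
  cont := by
    have := G.cont
    fun_prop
  good := h.good G.good

variable [Nonempty (Fin k)]

lemma box_cut (hb : b.2 < 0) (G : GM P (Fin k)) {lo hi : Fin k → ℝ} (h : Box P G.F lo hi)
    (i : Fin k) {c : ℝ} (h1 : lo i < c) (h2 : c < hi i)
    (hl : Box P G.F lo (Function.update hi i c)) (hr : Box P G.F (Function.update lo i c) hi) :
    cls hb (bxG G h) = cls hb (bxG G hr) * cls hb (bxG G hl) := by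
  have hpos : 0 < hi i - lo i := by linarith
  have key : (c - lo i) / (hi i - lo i) * (hi i - lo i) = c - lo i := by field_simp
  apply cls_cut hb i _ _ _ (a := (c - lo i) / (hi i - lo i))
  · apply div_nonneg <;> linarith
  · rw [div_le_one hpos]; linarith
  · intro t _
    simp only [bxG]
    congr 1
    funext j
    by_cases e : j = i
    · subst e; simp only [bxm, Function.update_self]; rw [mul_right_comm, key]; ring
    · simp [bxm, e]
  · intro t _
    simp only [bxG]
    congr 1
    funext j
    by_cases e : j = i
    · subst e; simp only [bxm, Function.update_self]
      have : (c - lo j) / (hi j - lo j) + (1 - (c - lo j) / (hi j - lo j)) * t j =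
        (c - lo j) / (hi j - lo j) * (1 - t j) + t j := by ring
      rw [this, add_mul, mul_right_comm, key]; ring
    · simp [bxm, e]

/-- shrinking a box around its only hit -/
lemma box_shrink (hb : b.2 < 0) (G : GM P (Fin k)) {lo hi : Fin k → ℝ} (h : Box P G.F lo hi)
    {x : Fin k → ℝ}
    (hu : ∀ x' ∈ Hs P G.F, (∀ i, lo i ≤ x' i ∧ x' i ≤ hi i) → x' = x)
    {ε : ℝ} (hε : 0 < ε) (hl : ∀ i, lo i ≤ x i - ε) (hh : ∀ i, x i + ε ≤ hi i)
    (h' : Box P G.F (fun i => x i - ε) (fun i => x i + ε)) :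
    cls hb (bxG G h) = cls hb (bxG G h') := by
  have hc := G.cont
  apply cls_eq_of_PH
  refine ⟨fun q => G.F (bxm (fun i => (1 - q.1) * lo i + q.1 * (x i - ε))
    (fun i => (1 - q.1) * hi i + q.1 * (x i + ε)) q.2), by fun_prop, ?_, ?_, ?_⟩
  · intro s h0 h1
    have a1 : ∀ i, lo i ≤ (1 - s) * lo i + s * (x i - ε) := fun i => by nlinarith [hl i]
    have a2 : ∀ i, (1 - s) * hi i + s * (x i + ε) ≤ hi i := fun i => by nlinarith [hh i]
    have a3 : ∀ i, (1 - s) * lo i + s * (x i - ε) < x i := fun i => by nlinarith [hl i]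
    have a4 : ∀ i, x i < (1 - s) * hi i + s * (x i + ε) := fun i => by nlinarith [hh i]
    have bx : Box P G.F (fun i => (1 - s) * lo i + s * (x i - ε))
        (fun i => (1 - s) * hi i + s * (x i + ε)) := by
      refine ⟨fun i => (h.l0 i).trans (a1 i), fun i => (a2 i).trans (h.h1 i),
        fun i => ((a3 i).trans (a4 i)).le, ?_⟩
      intro x' hx' hin
      have := hu x' hx' (fun i => ⟨(a1 i).trans (hin i).1, (hin i).2.trans (a2 i)⟩)
      subst this
      exact fun i => ⟨a3 i, a4 i⟩
    exact bx.good G.good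
  · intro t _
    simp [bxG]
  · intro t _
    simp [bxG]

/-- local analysis near a nondegenerate hit -/
lemma local_std (hb : b.2 < 0) (hP : Sep P) (G : GM P (Fin k)) {x : Fin k → ℝ}
    (hp : (G.F x).1 ∈ P) (hpos : 0 < (G.F x).2)
    {A : (Fin k → ℝ) →L[ℝ] (Fin k → ℝ)} (hA : HasFDerivAt (fun u => (G.F u).1) A x)
    (hdet : A.det ≠ 0) :
    ∃ ε₀ > 0, ∀ ε, 0 < ε → ε ≤ ε₀ → ∀ h' : Box P G.F (fun i => x i - ε) (fun i => x i + ε),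
      cls hb (bxG G h') = gen hb hP hp ∨ cls hb (bxG G h') = (gen hb hP hp)⁻¹ := by
  have hker : LinearMap.ker (A : (Fin k → ℝ) →ₗ[ℝ] (Fin k → ℝ)) = ⊥ := by
    by_contra hk
    exact hdet (LinearMap.det_eq_zero_iff_ker_ne_bot.2 hk)
  obtain ⟨K, hK, hanti⟩ := LinearMap.exists_antilipschitzWith _ hker
  have hanti' : ∀ v, ‖v‖ ≤ K * ‖A v‖ := by
    intro v
    have := hanti.le_mul_dist v 0
    simpa using this
  have hKpos : (0 : ℝ) < K := hK
  have hlo := hA.isLittleO.def (c := 1 / (2 * K)) (by positivity)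
  have hz : ∀ᶠ x' in 𝓝 x, 0 < (G.F x').2 :=
    (continuous_snd.comp G.cont).continuousAt.eventually (lt_mem_nhds hpos)
  have hn : ∀ᶠ x' in 𝓝 x, ‖(G.F x').1 - (G.F x).1‖ < 1 := by
    have h1 : Continuous (fun x' => ‖(G.F x').1 - (G.F x).1‖) := by
      have := G.cont
      fun_prop
    exact h1.continuousAt.eventually (gt_mem_nhds (by simp))
  obtain ⟨δ, hδ, hball⟩ := Metric.eventually_nhds_iff.1 (hlo.and (hz.and hn))
  refine ⟨δ / 2, by positivity, ?_⟩
  intro ε hε hεδ h'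
  let B : Matrix (Fin k) (Fin k) ℝ := ε • LinearMap.toMatrix' (A : (Fin k → ℝ) →ₗ[ℝ] (Fin k → ℝ))
  have hB : B.det ≠ 0 := by
    rw [det_smul, LinearMap.det_toMatrix']
    exact mul_ne_zero (pow_ne_zero _ hε.ne') hdet
  have hBv : ∀ t, B *ᵥ cen t = A (ε • cen t) := by
    intro t
    simp only [B]
    rw [smul_mulVec, LinearMap.toMatrix'_mulVec, map_smul]; rfl
  have hbx : ∀ t, bxm (fun i => x i - ε) (fun i => x i + ε) t = x + ε • cen t := by
    intro t; funext i
    simp [bxm, cen]; ring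
  have heq : cls hb (bxG G h') = cls hb (stdG hP hp B hB) := by
    apply cls_eq_of_PH
    apply PH_line (bxG G h').cont (stdG hP hp B hB).cont
    intro s h0 h1
    have info : ∀ t ∈ cube (Fin k), ‖(G.F (x + ε • cen t)).1 - (G.F x).1 - A (ε • cen t)‖ ≤
        1 / (2 * K) * ‖ε • cen t‖ ∧ 0 < (G.F (x + ε • cen t)).2 ∧
        ‖(G.F (x + ε • cen t)).1 - (G.F x).1‖ < 1 := by
      intro t ht
      have hd : dist (x + ε • cen t) x < δ := by
        rw [dist_eq_norm, add_sub_cancel_left, norm_smul, Real.norm_eq_abs, abs_of_pos hε]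
        have : ‖cen t‖ ≤ 1 := by
          rw [pi_norm_le_iff_of_nonneg zero_le_one]
          intro i
          have := ht i
          rw [Real.norm_eq_abs, abs_le]; simp only [cen]; constructor <;> linarith
        nlinarith
      have := hball hd
      rw [add_sub_cancel_left] at this
      exact this
    have e1 : ∀ t, ((bxG G h').F t + s • ((stdG hP hp B hB).F t - (bxG G h').F t)).1 =
        (G.F x).1 + ((1 - s) • ((G.F (x + ε • cen t)).1 - (G.F x).1) + s • gg (A (ε • cen t))) := by
      intro t
      simp only [bxG, stdG, stdF, hbx, hBv, Prod.fst_add, Prod.smul_fst, Prod.fst_sub]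
      module
    have e2 : ∀ t, ((bxG G h').F t + s • ((stdG hP hp B hB).F t - (bxG G h').F t)).2 =
        (1 - s) * (G.F (x + ε • cen t)).2 + s := by
      intro t
      simp only [bxG, stdG, stdF, hbx, Prod.snd_add, Prod.smul_snd, Prod.snd_sub, smul_eq_mul]
      ring
    have hzpos : ∀ t ∈ cube (Fin k), 0 < (1 - s) * (G.F (x + ε • cen t)).2 + s := by
      intro t ht
      have := (info t ht).2.1
      rcases h0.eq_or_lt with e | e
      · rw [← e]; simpa using this
      · nlinarith
    constructor
    · intro t ht _
      simp only [e2]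
      exact (hzpos t ht).ne'
    · intro t ht htb hmem
      exfalso
      simp only [e1] at hmem
      obtain ⟨i1, _, i3⟩ := info t ht
      set v := ε • cen t with hv
      have hv0 : v ≠ 0 := smul_ne_zero hε.ne' (cen_ne htb)
      have hvn : 0 < ‖v‖ := norm_pos_iff.2 hv0
      have hlt : ‖(1 - s) • ((G.F (x + v)).1 - (G.F x).1) + s • gg (A v)‖ < 1 := by
        refine (norm_add_le _ _).trans_lt ?_
        rw [norm_smul, norm_smul, Real.norm_eq_abs, Real.norm_eq_abs, abs_of_nonneg h0,
          abs_of_nonneg (by linarith)]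
        have := gg_norm (A v)
        rcases h0.eq_or_lt with e | e
        · rw [← e]; simpa using i3
        · nlinarith
      have e3 := hP _ hp _ hmem (by simpa using hlt)
      rw [add_eq_left] at e3
      have hAv := hanti' v
      have hAvpos : 0 < ‖A v‖ := by
        by_contra hc
        have : ‖A v‖ = 0 := le_antisymm (not_lt.1 hc) (norm_nonneg _)
        rw [this] at hAv; simp at hAv; exact hv0 hAv
      set o := (G.F (x + v)).1 - (G.F x).1 - A v with ho
      have ho2 : 2 * ‖o‖ ≤ ‖A v‖ := by
        have : 1 / (2 * (K : ℝ)) * ‖v‖ ≤ 1 / (2 * K) * (K * ‖A v‖) := by gcongr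
        have e4 : 1 / (2 * (K : ℝ)) * (K * ‖A v‖) = ‖A v‖ / 2 := by field_simp
        linarith
      have e5 : ((1 - s) + s * (1 + ‖A v‖)⁻¹) • A v = -((1 - s) • o) := by
        have : (G.F (x + v)).1 - (G.F x).1 = A v + o := by rw [ho]; abel
        rw [this, gg] at e3
        rw [eq_neg_iff_add_eq_zero, ← e3]
        module
      have hinv : 0 < (1 + ‖A v‖)⁻¹ := by positivity
      have e6 := congrArg norm e5
      rw [norm_neg, norm_smul, norm_smul, Real.norm_eq_abs, Real.norm_eq_abs,
        abs_of_nonneg (by linarith : 0 ≤ 1 - s),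
        abs_of_nonneg (by have := mul_nonneg h0 hinv.le; linarith)] at e6
      rcases h0.eq_or_lt with e | e
      · rw [← e] at e6; simp at e6; linarith
      · have : 0 < s * (1 + ‖A v‖)⁻¹ * ‖A v‖ := by positivity
        nlinarith [mul_nonneg (by linarith : 0 ≤ 1 - s) (norm_nonneg o)]
  rw [heq]
  exact std_eq_gen hb hP hp hB

end

end UC

namespace UC

open Topology unitInterval Set Topology.Homotopy Matrix

set_option linter.unusedSectionVars false

noncomputable section

variable {k : ℕ}
variable {P : Set (Fin k → ℝ)} {b : E k}

/-- all hits are nondegenerate -/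
def Reg (P : Set (Fin k → ℝ)) (F : (Fin k → ℝ) → E k) : Prop :=
  ∀ u, (F u).1 ∈ P → 0 < (F u).2 →
    ∃ A : (Fin k → ℝ) →L[ℝ] (Fin k → ℝ), HasFDerivAt (fun u => (F u).1) A u ∧ A.det ≠ 0

lemma finite_hits (hPc : IsClosed P) (hP : Sep P) (G : GM P (Fin k)) (hr : Reg P G.F) :
    (Hs P G.F).Finite := by
  by_contra hinf
  have hK : IsCompact (cube (Fin k) ∩ {x | (G.F x).1 ∈ P ∧ 0 ≤ (G.F x).2}) := by
    apply isCompact_cube.inter_right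
    have hc := G.cont
    exact (hPc.preimage (continuous_fst.comp hc)).inter (isClosed_le continuous_const (continuous_snd.comp hc))
  obtain ⟨x, ⟨hx1, hx2, hx3⟩, hacc⟩ := Set.Infinite.exists_accPt_of_subset_isCompact hinf hK
    (fun x hx => ⟨hx.1, hx.2.1, hx.2.2.le⟩)
  have hpos : 0 < (G.F x).2 := lt_of_le_of_ne hx3 (G.good.mem x hx1 hx2).symm
  obtain ⟨A, hA, hdet⟩ := hr x hx2 hpos
  have hker : LinearMap.ker (A : (Fin k → ℝ) →ₗ[ℝ] (Fin k → ℝ)) = ⊥ := by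
    by_contra hk
    exact hdet (LinearMap.det_eq_zero_iff_ker_ne_bot.2 hk)
  obtain ⟨K, hK, hanti⟩ := LinearMap.exists_antilipschitzWith _ hker
  have hne := hA.eventually_ne (c := (G.F x).1) ⟨K, hanti⟩
  rw [eventually_nhdsWithin_iff] at hne
  have hn : ∀ᶠ x' in 𝓝 x, ‖(G.F x').1 - (G.F x).1‖ < 1 := by
    have h1 : Continuous (fun x' => ‖(G.F x').1 - (G.F x).1‖) := by
      have := G.cont
      fun_prop
    exact h1.continuousAt.eventually (gt_mem_nhds (by simp))
  rw [accPt_iff_frequently] at hacc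
  obtain ⟨y, ⟨hy1, hy2⟩, hy3, hy4⟩ := (hacc.and_eventually (hne.and hn)).exists
  exact hy3 hy1 (hP _ hx2 _ hy2.2.1 hy4)

variable [Nonempty (Fin k)]

/-- the subgroup generated by the standard classes -/
def genSub (hb : b.2 < 0) (hP : Sep P) : Subgroup (HomotopyGroup (Fin k) (XS P) (bp P b hb)) :=
  Subgroup.closure {x | ∃ (p : Fin k → ℝ) (hp : p ∈ P), x = gen hb hP hp}

lemma box_mem (hb : b.2 < 0) (hP : Sep P) (G : GM P (Fin k)) (hr : Reg P G.F)
    (hfin : (Hs P G.F).Finite) :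
    ∀ (n : ℕ) (lo hi : Fin k → ℝ) (h : Box P G.F lo hi),
      (Hs P G.F ∩ {x | ∀ i, lo i ≤ x i ∧ x i ≤ hi i}).ncard = n → cls hb (bxG G h) ∈ genSub hb hP := by
  intro n
  induction n using Nat.strong_induction_on with
  | _ n ih =>
  intro lo hi h hcard
  set S := Hs P G.F ∩ {x | ∀ i, lo i ≤ x i ∧ x i ≤ hi i} with hS
  have hSf : S.Finite := hfin.inter_of_left _
  rcases S.eq_empty_or_nonempty with he | ⟨x, hx⟩
  · rw [cls_of_VS hb (bxG G h), lc_one]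
    · exact one_mem _
    · intro t ht
      apply not_hit G.good (h.cube ht)
      intro hh
      have : bxm lo hi t ∈ S := ⟨hh, fun i => bxm_mem h.le ht i⟩
      rw [he] at this
      exact this
  by_cases hone : ∀ y ∈ S, y = x
  · obtain ⟨A, hA, hdet⟩ := hr x hx.1.2.1 hx.1.2.2
    obtain ⟨ε₀, hε₀, hloc⟩ := local_std hb hP G hx.1.2.1 hx.1.2.2 hA hdet
    have hinner := h.int x hx.1 hx.2
    obtain ⟨ε, hε, hεle, hε1⟩ : ∃ ε, 0 < ε ∧ ε ≤ ε₀ ∧ ∀ i, ε ≤ min (x i - lo i) (hi i - x i) := by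
      let m := Finset.univ.inf' Finset.univ_nonempty (fun i => min (x i - lo i) (hi i - x i))
      refine ⟨min ε₀ m, lt_min hε₀ ?_, min_le_left _ _, fun i => (min_le_right _ _).trans
        (Finset.inf'_le _ (Finset.mem_univ i))⟩
      rw [Finset.lt_inf'_iff]
      intro i _
      exact lt_min (by linarith [(hinner i).1]) (by linarith [(hinner i).2])
    have hl : ∀ i, lo i ≤ x i - ε := fun i => by linarith [(hε1 i).trans (min_le_left _ _)]
    have hh : ∀ i, x i + ε ≤ hi i := fun i => by linarith [(hε1 i).trans (min_le_right _ _)]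
    have h' : Box P G.F (fun i => x i - ε) (fun i => x i + ε) := by
      refine ⟨fun i => (h.l0 i).trans (hl i), fun i => (hh i).trans (h.h1 i),
        fun i => by linarith, ?_⟩
      intro y hy hin
      have := hone y ⟨hy, fun i => ⟨(hl i).trans (hin i).1, (hin i).2.trans (hh i)⟩⟩
      subst this
      exact fun i => ⟨by linarith, by linarith⟩
    rw [box_shrink hb G h (x := x) (fun y hy hin => hone y ⟨hy, hin⟩) hε hl hh h']
    have hg : gen hb hP hx.1.2.1 ∈ genSub hb hP := Subgroup.subset_closure ⟨_, _, rfl⟩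
    rcases hloc ε hε hεle h' with e | e
    · rw [e]; exact hg
    · rw [e]; exact inv_mem hg
  · push Not at hone
    have : ∃ y ∈ S, ∃ z ∈ S, ∃ i, y i < z i := by
      obtain ⟨y, hy, hyx⟩ := hone
      obtain ⟨i, hi⟩ := Function.ne_iff.1 hyx
      rcases lt_or_gt_of_ne hi with h | h
      · exact ⟨y, hy, x, hx, i, h⟩
      · exact ⟨x, hx, y, hy, i, h⟩
    obtain ⟨y, hy, z, hz, i, hyz⟩ := this
    obtain ⟨c, hc, hcn⟩ : ∃ c ∈ Ioo (y i) (z i), c ∉ (fun x => x i) '' Hs P G.F := by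
      have := (Set.Ioo_infinite hyz).sdiff (hfin.image (fun x => x i))
      obtain ⟨c, hc⟩ := this.nonempty
      exact ⟨c, hc.1, hc.2⟩
    have hyi := hy.2 i
    have hzi := hz.2 i
    have hlc : lo i < c := lt_of_le_of_lt hyi.1 hc.1
    have hch : c < hi i := lt_of_lt_of_le hc.2 hzi.2
    have hne : ∀ w ∈ Hs P G.F, w i ≠ c := fun w hw e => hcn ⟨w, hw, e⟩
    have bl : Box P G.F lo (Function.update hi i c) := by
      refine ⟨h.l0, ?_, ?_, ?_⟩
      · intro j; by_cases e : j = i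
        · subst e; simp; linarith [h.h1 j]
        · simp [e, h.h1 j]
      · intro j; by_cases e : j = i
        · subst e; simp; linarith
        · simp [e, h.le j]
      · intro w hw hin
        have hin2 : ∀ j, lo j ≤ w j ∧ w j ≤ hi j := by
          intro j; have := hin j
          by_cases e : j = i
          · subst e; simp at this; exact ⟨this.1, by linarith⟩
          · simpa [e] using this
        intro j
        have h2 := h.int w hw hin2 j
        by_cases e : j = i
        · subst e; have := (hin j).2; simp at this
          simp; exact ⟨h2.1, lt_of_le_of_ne this (hne w hw)⟩
        · simpa [e] using h2
    have br : Box P G.F (Function.update lo i c) hi := by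
      refine ⟨?_, h.h1, ?_, ?_⟩
      · intro j; by_cases e : j = i
        · subst e; simp; linarith [h.l0 j]
        · simp [e, h.l0 j]
      · intro j; by_cases e : j = i
        · subst e; simp; linarith
        · simp [e, h.le j]
      · intro w hw hin
        have hin2 : ∀ j, lo j ≤ w j ∧ w j ≤ hi j := by
          intro j; have := hin j
          by_cases e : j = i
          · subst e; simp at this; exact ⟨by linarith, this.2⟩
          · simpa [e] using this
        intro j
        have h2 := h.int w hw hin2 j
        by_cases e : j = i
        · subst e; have := (hin j).1; simp at this
          simp; exact ⟨lt_of_le_of_ne this (hne w hw).symm, h2.2⟩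
        · simpa [e] using h2
    rw [box_cut hb G h i hlc hch bl br]
    refine mul_mem (ih _ ?_ _ _ br rfl) (ih _ ?_ _ _ bl rfl)
    · rw [← hcard]
      refine Set.ncard_lt_ncard ⟨?_, fun hss => ?_⟩ hSf
      · rintro w ⟨hw, hin⟩
        refine ⟨hw, fun j => ?_⟩
        have := hin j
        by_cases e : j = i
        · subst e; simp at this; exact ⟨by linarith, this.2⟩
        · simpa [e] using this
      · have := (hss hy).2 i
        simp at this
        linarith [hc.1]
    · rw [← hcard]
      refine Set.ncard_lt_ncard ⟨?_, fun hss => ?_⟩ hSf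
      · rintro w ⟨hw, hin⟩
        refine ⟨hw, fun j => ?_⟩
        have := hin j
        by_cases e : j = i
        · subst e; simp at this; exact ⟨this.1, by linarith⟩
        · simpa [e] using this
      · have := (hss hz).2 i
        simp at this
        linarith [hc.2]

/-- generation -/
theorem genSub_eq_top (hPcl : IsClosed P) (hPc : P.Countable) (hb : b.2 < 0) (hP : Sep P) :
    genSub hb hP = ⊤ := by
  rw [eq_top_iff]
  rintro x -
  obtain ⟨f, rfl⟩ := exists_cls hb x
  obtain ⟨G, -, hcls, hreg⟩ := exists_regular hPcl hPc hb f (ContinuousLinearMap.id ℝ _)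
  have hreg' : Reg P G.F := hreg
  have hbox : Box P G.F (fun _ => 0) (fun _ => 1) := by
    refine ⟨fun _ => le_rfl, fun _ => le_rfl, fun _ => zero_le_one, ?_⟩
    intro x hx _ i
    have hx1 := hx.1 i
    have hnb : x ∉ bd (Fin k) := fun hbd => absurd (G.good.bdm x hx.1 hbd hx.2.1) (not_lt.2 hx.2.2.le)
    have h0 : x i ≠ 0 := fun e => hnb ⟨i, Or.inl e⟩
    have h1 : x i ≠ 1 := fun e => hnb ⟨i, Or.inr e⟩
    exact ⟨lt_of_le_of_ne hx1.1 h0.symm, lt_of_le_of_ne hx1.2 h1⟩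
  have := box_mem hb hP G hreg' (finite_hits hPcl hP G hreg') _ _ _ hbox rfl
  have e : bxG G hbox = G := by
    cases G
    simp only [bxG, GM.mk.injEq]
    funext t
    congr 1
    funext i
    simp [bxm]
  rw [e, hcls] at this
  exact this

end

end UC

namespace UC

open Set

noncomputable section

variable {k : ℕ}

/-- grid vertices, direction `0` is the homotopy direction -/
abbrev Gv (k : ℕ) : Type := Fin (k + 1) → ℕ

/-- unit step -/
def st (c : Fin (k + 1)) : Gv k := Pi.single c 1

/-- difference operator -/
def Df (c : Fin (k + 1)) (f : Gv k → ℤ) (q : Gv k) : ℤ := f (q + st c) - f q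

/-- partial path, omitting the zeroth step -/
def pos1 (s : Equiv.Perm (Fin (k + 1))) (i : Fin (k + 1)) : Gv k :=
  ∑ l with 0 < l ∧ l < i, st (s l)

/-- partial path -/
def pos0 (s : Equiv.Perm (Fin (k + 1))) (i : Fin (k + 1)) : Gv k :=
  ∑ l with l < i, st (s l)

lemma pos0_eq (s : Equiv.Perm (Fin (k + 1))) {i : Fin (k + 1)} (hi : 0 < i) :
    pos0 s i = st (s 0) + pos1 s i := by
  have : (Finset.univ.filter (fun l : Fin (k + 1) => l < i)) =
      insert 0 (Finset.univ.filter (fun l : Fin (k + 1) => 0 < l ∧ l < i)) := by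
    ext l
    simp only [Finset.mem_filter, Finset.mem_univ, true_and, Finset.mem_insert]
    constructor
    · intro h
      rcases Fin.eq_zero_or_eq_succ l with e | ⟨j, e⟩
      · left; exact e
      · right; exact ⟨by rw [e]; exact Fin.succ_pos j, h⟩
    · rintro (h | h)
      · rw [h]; exact hi
      · exact h.2
  rw [pos0, this, Finset.sum_insert (by simp)]
  rfl

/-- product of the differences along a path without the zeroth step -/
def Wt (X : Fin (k + 1) → Gv k → ℤ) (s : Equiv.Perm (Fin (k + 1))) (q : Gv k) : ℤ :=
  ∏ i with 0 < i, Df (s i) (X i) (q + pos1 s i)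

/-- full product -/
def Ft (X : Fin (k + 1) → Gv k → ℤ) (s : Equiv.Perm (Fin (k + 1))) (q : Gv k) : ℤ :=
  ∏ i, Df (s i) (X i) (q + pos0 s i)

lemma Ft_eq (X : Fin (k + 1) → Gv k → ℤ) (s : Equiv.Perm (Fin (k + 1))) (q : Gv k) :
    Ft X s q = Df (s 0) (fun v => X 0 v * Wt X s v) q - X 0 q * Df (s 0) (Wt X s) q := by
  have h1 : Ft X s q = Df (s 0) (X 0) q * Wt X s (q + st (s 0)) := by
    have : (Finset.univ : Finset (Fin (k + 1))) =
        insert 0 (Finset.univ.filter (fun l : Fin (k + 1) => 0 < l)) := by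
      ext l
      simp only [Finset.mem_univ, Finset.mem_insert, Finset.mem_filter, true_and, true_iff]
      rcases Fin.eq_zero_or_eq_succ l with e | ⟨j, e⟩
      · left; exact e
      · right; rw [e]; exact Fin.succ_pos j
    rw [Ft, this, Finset.prod_insert (by simp)]
    congr 1
    · simp [pos0]
    · rw [Wt]
      refine Finset.prod_congr rfl (fun i hi => ?_)
      rw [pos0_eq s (by simpa using hi), add_assoc]
  rw [h1]
  simp only [Df]
  ring

/-- the terms in the Leibniz expansion -/
def Tj (X : Fin (k + 1) → Gv k → ℤ) (q : Gv k) (j : Fin (k + 1)) (s : Equiv.Perm (Fin (k + 1))) : ℤ :=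
  Df (s 0) (Df (s j) (X j)) (q + pos1 s j) *
    (∏ i with 0 < i ∧ i < j, Df (s i) (X i) (q + pos1 s i)) *
    (∏ i with j < i, Df (s i) (X i) (q + pos0 s i))

lemma Df_Wt (X : Fin (k + 1) → Gv k → ℤ) (s : Equiv.Perm (Fin (k + 1))) (q : Gv k) :
    Df (s 0) (Wt X s) q = ∑ j with 0 < j, Tj X q j s := by
  have h := Finset.prod_sub_ordered (Finset.univ.filter (fun l : Fin (k + 1) => 0 < l))
    (fun i => Df (s i) (X i) (q + st (s 0) + pos1 s i))
    (fun i => Df (s i) (X i) (q + st (s 0) + pos1 s i) - Df (s i) (X i) (q + pos1 s i))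
  simp only [sub_sub_cancel] at h
  have h2 : Df (s 0) (Wt X s) q = (∏ i with 0 < i, Df (s i) (X i) (q + st (s 0) + pos1 s i)) -
    ∏ i with 0 < i, Df (s i) (X i) (q + pos1 s i) := rfl
  rw [h2, h, sub_sub_cancel]
  refine Finset.sum_congr rfl (fun j hj => ?_)
  have hj' : 0 < j := by simpa using hj
  rw [Tj]
  congr 1
  · congr 1
    · simp only [Df]
      rw [add_right_comm q (pos1 s j) (st (s 0))]
    · refine Finset.prod_congr ?_ (fun _ _ => rfl)
      ext i; simp
  · refine Finset.prod_congr ?_ (fun i hi => ?_)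
    · ext i
      simp only [Finset.mem_filter, Finset.mem_univ, true_and, and_iff_right_iff_imp]
      exact fun h => hj'.trans h
    · rw [Finset.mem_filter] at hi
      rw [pos0_eq s (hj'.trans hi.2), add_assoc]

lemma Tj_swap (X : Fin (k + 1) → Gv k → ℤ) (q : Gv k) {j : Fin (k + 1)} (hj : 0 < j)
    (s : Equiv.Perm (Fin (k + 1))) : Tj X q j (s * Equiv.swap 0 j) = Tj X q j s := by
  have hp1 : ∀ i, i ≤ j → pos1 (s * Equiv.swap 0 j) i = pos1 s i := by
    intro i hi
    refine Finset.sum_congr rfl (fun l hl => ?_)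
    simp only [Finset.mem_filter, Finset.mem_univ, true_and] at hl
    rw [Equiv.Perm.mul_apply, Equiv.swap_apply_of_ne_of_ne hl.1.ne' (hl.2.trans_le hi).ne]
  have hp0 : ∀ i, j < i → pos0 (s * Equiv.swap 0 j) i = pos0 s i := by
    intro i hi
    refine Finset.sum_equiv (Equiv.swap 0 j) (fun l => ?_) (fun l _ => rfl)
    simp only [Finset.mem_filter, Finset.mem_univ, true_and]
    by_cases h0 : l = 0
    · subst h0; simp [hi, hj.trans hi]
    by_cases h1 : l = j
    · subst h1; simp [hi, hj.trans hi]
    rw [Equiv.swap_apply_of_ne_of_ne h0 h1]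
  simp only [Tj]
  congr 1
  · congr 1
    · rw [hp1 j le_rfl]
      simp only [Df, Equiv.Perm.mul_apply, Equiv.swap_apply_left, Equiv.swap_apply_right]
      rw [add_right_comm _ (st (s j)) (st (s 0))]
      ring
    · refine Finset.prod_congr rfl (fun i hi => ?_)
      simp only [Finset.mem_filter, Finset.mem_univ, true_and] at hi
      rw [hp1 i hi.2.le, Equiv.Perm.mul_apply, Equiv.swap_apply_of_ne_of_ne hi.1.ne' hi.2.ne]
  · refine Finset.prod_congr rfl (fun i hi => ?_)
    simp only [Finset.mem_filter, Finset.mem_univ, true_and] at hi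
    rw [hp0 i hi, Equiv.Perm.mul_apply, Equiv.swap_apply_of_ne_of_ne (hj.trans hi).ne' hi.ne']

/-- sign of a permutation as an integer -/
def sg (s : Equiv.Perm (Fin (k + 1))) : ℤ := (Equiv.Perm.sign s : ℤ)

lemma sum_Tj (X : Fin (k + 1) → Gv k → ℤ) (q : Gv k) {j : Fin (k + 1)} (hj : 0 < j) :
    ∑ s, sg s * Tj X q j s = 0 := by
  have h : ∑ s, sg s * Tj X q j s = ∑ s, sg (s * Equiv.swap 0 j) * Tj X q j (s * Equiv.swap 0 j) :=
    (Equiv.sum_comp (Equiv.mulRight (Equiv.swap 0 j)) (fun s => sg s * Tj X q j s)).symm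
  have h2 : ∀ s : Equiv.Perm (Fin (k + 1)), sg (s * Equiv.swap 0 j) = - sg s := by
    intro s
    simp [sg, Equiv.Perm.sign_mul, Equiv.Perm.sign_swap hj.ne]
  simp only [h2, Tj_swap X q hj, neg_mul, Finset.sum_neg_distrib] at h
  linarith

/-- `d d = 0` -/
lemma sum_DW (X : Fin (k + 1) → Gv k → ℤ) (q : Gv k) :
    ∑ s : Equiv.Perm (Fin (k + 1)), sg s * Df (s 0) (Wt X s) q = 0 := by
  simp only [Df_Wt, Finset.mul_sum]
  rw [Finset.sum_comm]
  exact Finset.sum_eq_zero (fun j hj => sum_Tj X q (by simpa using hj))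

/-- box of grid points -/
def bxs (n : Gv k) : Finset (Gv k) := Fintype.piFinset (fun c => Finset.range (n c))

lemma mem_bxs {n q : Gv k} : q ∈ bxs n ↔ ∀ c, q c < n c := by simp [bxs]

lemma sum_Df (n : Gv k) (c : Fin (k + 1)) (f : Gv k → ℤ) :
    ∑ q ∈ bxs n, Df c f q = ∑ q ∈ bxs (Function.update n c 1),
      (f (Function.update q c (n c)) - f (Function.update q c 0)) := by
  have h : ∑ q ∈ bxs n, Df c f q = ∑ x ∈ bxs (Function.update n c 1) ×ˢ Finset.range (n c),
      Df c f (Function.update x.1 c x.2) := by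
    symm
    refine Finset.sum_nbij' (fun x => Function.update x.1 c x.2) (fun q => (Function.update q c 0, q c))
      ?_ ?_ ?_ ?_ ?_
    · rintro ⟨q, j⟩ h
      simp only [Finset.mem_product, mem_bxs, Finset.mem_range] at h ⊢
      intro d
      have := h.1 d
      by_cases e : d = c
      · subst e; simpa using h.2
      · simpa [e] using this
    · intro q h
      simp only [Finset.mem_product, mem_bxs, Finset.mem_range] at h ⊢
      refine ⟨fun d => ?_, h c⟩
      by_cases e : d = c
      · subst e; simp
      · simpa [e] using h d
    · rintro ⟨q, j⟩ h
      simp only [Finset.mem_product, mem_bxs, Finset.mem_range] at h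
      have := h.1 c
      simp only [Function.update_self, Nat.lt_one_iff] at this
      simp [← this]
    · intro q _; simp
    · intro q _; rfl
  rw [h, Finset.sum_product]
  refine Finset.sum_congr rfl (fun q _ => ?_)
  rw [← Finset.sum_range_sub (fun j => f (Function.update q c j))]
  refine Finset.sum_congr rfl (fun j _ => ?_)
  simp only [Df]
  congr 2
  funext d
  by_cases e : d = c
  · subst e; simp [st]
  · simp [st, e]

/-- the degree functional -/
def Ph (n : Gv k) (X : Fin (k + 1) → Gv k → ℤ) : ℤ :=
  ∑ s : Equiv.Perm (Fin (k + 1)) with s 0 = 0, sg s *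
    ∑ q ∈ bxs (Function.update n 0 1), X 0 q * Wt X s q

lemma pos1_zero {s : Equiv.Perm (Fin (k + 1))} {c : Fin (k + 1)} (hs : s 0 = c) (i : Fin (k + 1)) :
    pos1 s i c = 0 := by
  rw [pos1, Finset.sum_apply]
  refine Finset.sum_eq_zero (fun l hl => ?_)
  simp only [Finset.mem_filter, Finset.mem_univ, true_and] at hl
  have : s l ≠ c := by
    rw [← hs]; intro e; exact hl.1.ne' (s.injective e)
  simp [st, this.symm]

lemma st_zero {s : Equiv.Perm (Fin (k + 1))} {c i : Fin (k + 1)} (hs : s 0 = c) (hi : 0 < i) :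
    st (s i) c = 0 := by
  have : s i ≠ c := by
    rw [← hs]; intro e; exact hi.ne' (s.injective e)
  simp [st, this.symm]

/-- discrete Stokes -/
theorem stokes (hk : 0 < k) (n : Gv k) (X Y Z : Fin (k + 1) → Gv k → ℤ) (β : Fin (k + 1) → ℤ)
    (hwall : ∀ i q c, c ≠ 0 → (q c = 0 ∨ q c = n c) → X i q = β i)
    (hF : ∀ s q, Ft X s q = 0)
    (hY : ∀ i q, q 0 = 0 → X i q = Y i q)
    (hZ : ∀ i q, q 0 = n 0 → X i q = Z i q)
    (hZ' : ∀ i q m, Z i (Function.update q 0 m) = Z i q) : Ph n Y = Ph n Z := by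
  have h1 : ∑ q ∈ bxs n, ∑ s, sg s * Ft X s q = 0 :=
    Finset.sum_eq_zero (fun q _ => Finset.sum_eq_zero (fun s _ => by rw [hF, mul_zero]))
  have h2 : ∀ q, ∑ s, sg s * Ft X s q = ∑ s, sg s * Df (s 0) (fun v => X 0 v * Wt X s v) q := by
    intro q
    have := sum_DW X q
    simp only [Ft_eq, mul_sub, Finset.sum_sub_distrib]
    have e : ∑ s : Equiv.Perm (Fin (k + 1)), sg s * (X 0 q * Df (s 0) (Wt X s) q) =
        X 0 q * ∑ s : Equiv.Perm (Fin (k + 1)), sg s * Df (s 0) (Wt X s) q := by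
      rw [Finset.mul_sum]
      exact Finset.sum_congr rfl (fun s _ => by ring)
    rw [e, this, mul_zero, sub_zero]
  simp only [h2] at h1
  rw [Finset.sum_comm] at h1
  simp only [← Finset.mul_sum, sum_Df] at h1
  rw [← Finset.sum_filter_add_sum_filter_not Finset.univ
    (fun s : Equiv.Perm (Fin (k + 1)) => s 0 = 0)] at h1
  have h3 : ∑ s : Equiv.Perm (Fin (k + 1)) with ¬ s 0 = 0, sg s *
      ∑ q ∈ bxs (Function.update n (s 0) 1),
      (X 0 (Function.update q (s 0) (n (s 0))) * Wt X s (Function.update q (s 0) (n (s 0))) -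
        X 0 (Function.update q (s 0) 0) * Wt X s (Function.update q (s 0) 0)) = 0 := by
    refine Finset.sum_eq_zero (fun s hs => ?_)
    simp only [Finset.mem_filter, Finset.mem_univ, true_and] at hs
    have hW : ∀ v : Gv k, (v (s 0) = 0 ∨ v (s 0) = n (s 0)) → Wt X s v = 0 := by
      intro v hv
      have hl : (0 : Fin (k + 1)) < Fin.last k := by
        rw [Fin.lt_def]; simpa using hk
      refine Finset.prod_eq_zero (i := Fin.last k) (by simpa using hl) ?_
      simp only [Df]
      rw [hwall (Fin.last k) _ (s 0) hs, hwall (Fin.last k) _ (s 0) hs, sub_self]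
      · simpa [pos1_zero] using hv
      · simpa [pos1_zero, st_zero rfl hl] using hv
    rw [Finset.sum_eq_zero, mul_zero]
    intro q _
    rw [hW _ (by simp), hW _ (by simp)]; simp
  rw [h3, add_zero] at h1
  have h4 : ∑ s : Equiv.Perm (Fin (k + 1)) with s 0 = 0, sg s *
      ∑ q ∈ bxs (Function.update n (s 0) 1),
      (X 0 (Function.update q (s 0) (n (s 0))) * Wt X s (Function.update q (s 0) (n (s 0))) -
        X 0 (Function.update q (s 0) 0) * Wt X s (Function.update q (s 0) 0)) = Ph n Z - Ph n Y := by
    rw [Ph, Ph, ← Finset.sum_sub_distrib]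
    refine Finset.sum_congr rfl (fun s hs => ?_)
    simp only [Finset.mem_filter, Finset.mem_univ, true_and] at hs
    rw [← mul_sub, ← Finset.sum_sub_distrib, hs]
    congr 1
    refine Finset.sum_congr rfl (fun q hq => ?_)
    have hq0 : q 0 = 0 := by
      have := mem_bxs.1 hq 0
      simpa using this
    have e0 : Function.update q 0 0 = q := by
      funext c
      by_cases e : c = 0
      · subst e; simp [hq0]
      · simp [e]
    congr 1
    · rw [hZ 0 _ (by simp), hZ' 0]
      congr 1
      refine Finset.prod_congr rfl (fun i hi => ?_)
      have hi' : 0 < i := by simpa using hi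
      have eu : ∀ w : Gv k, w 0 = 0 → Function.update q 0 (n 0) + w = Function.update (q + w) 0 (n 0) := by
        intro w hw
        funext c
        by_cases e : c = 0
        · subst e; simp [hw]
        · simp [e]
      simp only [Df]
      rw [add_assoc, eu (pos1 s i + st (s i)) (by simp [pos1_zero hs, st_zero hs hi']),
        eu (pos1 s i) (pos1_zero hs i),
        hZ _ _ (by simp), hZ _ _ (by simp), hZ', hZ', add_assoc]
    · rw [e0, hY 0 _ hq0]
      congr 1
      refine Finset.prod_congr rfl (fun i hi => ?_)
      have hi' : 0 < i := by simpa using hi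
      simp only [Df]
      rw [hY _ _ (by simp [pos1_zero hs, st_zero hs hi', hq0]), hY _ _ (by simp [pos1_zero hs, hq0])]
  rw [h4] at h1
  linarith

end

end UC

namespace UC

open Topology unitInterval Set Topology.Homotopy Matrix

set_option linter.unusedSectionVars false

noncomputable section

variable {k : ℕ}

/-- coordinates relative to the puncture -/
def crd (p : Fin k → ℝ) (i : Fin (k + 1)) (x : E k) : ℝ :=
  Fin.cases x.2 (fun j => x.1 j - p j) i

/-- indicator of the half spaces -/
def ind (p : Fin k → ℝ) (i : Fin (k + 1)) (x : E k) : ℤ := if 0 ≤ crd p i x then 1 else 0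

lemma crd_sub (p : Fin k → ℝ) (i : Fin (k + 1)) (x y : E k) :
    |crd p i x - crd p i y| ≤ dist x y := by
  refine Fin.cases ?_ (fun j => ?_) i
  · simp only [crd, Fin.cases_zero]
    rw [← Real.dist_eq]
    exact (le_max_right _ _)
  · simp only [crd, Fin.cases_succ]
    have e : x.1 j - p j - (y.1 j - p j) = x.1 j - y.1 j := by ring
    rw [e, ← Real.dist_eq]
    exact (dist_le_pi_dist _ _ j).trans (le_max_left _ _)

lemma crd_lt {p : Fin k → ℝ} {x : E k} {δ : ℝ} (hδ : 0 < δ) (h : ∀ i, |crd p i x| < δ) :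
    dist x (p, 0) < δ := by
  rw [Prod.dist_eq]
  apply max_lt
  · rw [dist_pi_lt_iff hδ]
    intro j
    have := h j.succ
    simpa [crd, Real.dist_eq] using this
  · have := h 0
    simpa [crd, Real.dist_eq] using this

lemma ind_ne {p : Fin k → ℝ} {i : Fin (k + 1)} {x y h : E k} {δ : ℝ} (hxy : ind p i x ≠ ind p i y)
    (hx : dist x h < δ) (hy : dist y h < δ) : |crd p i h| < δ := by
  have h1 := abs_lt.1 ((crd_sub p i x h).trans_lt hx)
  have h2 := abs_lt.1 ((crd_sub p i y h).trans_lt hy)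
  rw [abs_lt]
  unfold ind at hxy
  split_ifs at hxy with h3 h4 h4
  · exact absurd rfl hxy
  · constructor <;> linarith
  · constructor <;> linarith
  · exact absurd rfl hxy

lemma exists_dist {Z : Type*} [TopologicalSpace Z] [CompactSpace Z] [Nonempty Z] {p : Fin k → ℝ}
    (H : C(Z, XS ({p} : Set (Fin k → ℝ)))) : ∃ δ > 0, ∀ z, δ ≤ dist (H z : E k) (p, 0) := by
  have hc : Continuous (fun z => dist (H z : E k) (p, 0)) := by
    have := H.continuous
    fun_prop
  obtain ⟨z, _, hz⟩ := isCompact_univ.exists_isMinOn (univ_nonempty) hc.continuousOn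
  refine ⟨_, ?_, fun w => hz (mem_univ w)⟩
  refine dist_pos.2 ?_
  intro h
  have := (H z).2
  rw [h] at this
  exact this rfl rfl

/-- the sampled indicators -/
def smp (p : Fin k → ℝ) (S : Gv k → E k) : Fin (k + 1) → Gv k → ℤ := fun i q => ind p i (S q)

lemma sum_st (s : Equiv.Perm (Fin (k + 1))) : ∑ l, st (s l) = (1 : Gv k) := by
  rw [Equiv.sum_comp s st]
  funext c
  simp [st, Finset.sum_apply, Pi.single_apply]

lemma sum_st_le (s : Equiv.Perm (Fin (k + 1))) (A : Finset (Fin (k + 1))) :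
    ∑ l ∈ A, st (s l) ≤ (1 : Gv k) := by
  rw [← sum_st s]
  exact Finset.sum_le_sum_of_subset (Finset.subset_univ _)

lemma pos0_le (s : Equiv.Perm (Fin (k + 1))) (i) : pos0 s i ≤ 1 := sum_st_le s _
lemma pos1_le (s : Equiv.Perm (Fin (k + 1))) (i) : pos1 s i ≤ 1 := sum_st_le s _

lemma pos0_st_le (s : Equiv.Perm (Fin (k + 1))) (i) : pos0 s i + st (s i) ≤ 1 := by
  have : pos0 s i + st (s i) = ∑ l ∈ insert i (Finset.univ.filter (fun l => l < i)), st (s l) := by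
    rw [Finset.sum_insert (by simp), add_comm]; rfl
  rw [this]; exact sum_st_le s _

lemma pos1_st_le (s : Equiv.Perm (Fin (k + 1))) (i) : pos1 s i + st (s i) ≤ 1 := by
  have : pos1 s i + st (s i) =
      ∑ l ∈ insert i (Finset.univ.filter (fun l => 0 < l ∧ l < i)), st (s l) := by
    rw [Finset.sum_insert (by simp), add_comm]; rfl
  rw [this]; exact sum_st_le s _

/-- uniform grid -/
def unif (M : ℕ) (j : ℕ) : I := projIcc (0 : ℝ) 1 zero_le_one ((j : ℝ) / M)

lemma unif_zero (M : ℕ) : unif M 0 = 0 := by simp [unif]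

lemma unif_self {M : ℕ} (hM : 0 < M) : unif M M = 1 := by
  have : (M : ℝ) ≠ 0 := by positivity
  simp [unif, this]

lemma unif_dist {M : ℕ} (hM : 0 < M) (j : ℕ) : dist (unif M (j + 1)) (unif M j) ≤ 1 / M := by
  rw [Subtype.dist_eq, Real.dist_eq]
  refine (abs_projIcc_sub_projIcc _).trans ?_
  have : (M : ℝ) > 0 := by positivity
  have e : ((j + 1 : ℕ) : ℝ) / M - j / M = 1 / M := by push_cast; ring
  rw [e, abs_of_pos (by positivity)]

/-- the grid point -/
def gpt (u : Fin k → ℕ → I) (q : Gv k) : Fin k → I := fun c => u c (q c.succ)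

/-- samples of a loop -/
def lsm {p : Fin k → ℝ} {x} (f : GenLoop (Fin k) (XS ({p} : Set (Fin k → ℝ))) x)
    (u : Fin k → ℕ → I) (q : Gv k) : E k := f (gpt u q)

lemma step_dist {u : ℕ → I} {η : ℝ} (hη : 0 < η) (h : ∀ j, dist (u (j + 1)) (u j) < η) (j w : ℕ)
    (hw : w ≤ 1) : dist (u (j + w)) (u j) < η := by
  interval_cases w
  · simpa using hη
  · exact h j

theorem Ph_homotopic (hk : 0 < k) {p : Fin k → ℝ} {x}
    {f g : GenLoop (Fin k) (XS ({p} : Set (Fin k → ℝ))) x}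
    (h : GenLoop.Homotopic f g) : ∃ η > 0, ∀ (u : Fin k → ℕ → I) (n : Fin k → ℕ),
      (∀ c, u c 0 = 0) → (∀ c, u c (n c) = 1) → (∀ c j, dist (u c (j + 1)) (u c j) < η) →
      Ph (Fin.cons 1 n) (smp p (lsm f u)) = Ph (Fin.cons 1 n) (smp p (lsm g u)) := by
  obtain ⟨H⟩ := h
  obtain ⟨δ, hδ, hH⟩ := exists_dist H.toContinuousMap
  have huc : UniformContinuous (fun z => (H z : E k)) :=
    CompactSpace.uniformContinuous_of_continuous (by have := H.continuous; fun_prop)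
  obtain ⟨η, hη, hu⟩ := Metric.uniformContinuous_iff.1 huc δ hδ
  refine ⟨η, hη, fun u n h0 h1 hs => ?_⟩
  obtain ⟨M, hM⟩ := exists_nat_one_div_lt hη
  have hM0 : 0 < M + 1 := by omega
  set v : Gv k → I × (Fin k → I) := fun q => (unif (M + 1) (q 0), gpt u q) with hv
  have hvd : ∀ q w, w ≤ 1 → dist (v (q + w)) (v q) < η := by
    intro q w hw
    rw [Prod.dist_eq]
    apply max_lt
    · apply step_dist hη _ _ _ (hw 0)
      intro j
      refine (unif_dist hM0 j).trans_lt ?_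
      push_cast; exact hM
    · rw [dist_pi_lt_iff hη]
      intro c
      exact step_dist hη (hs c) _ _ (hw c.succ)
  have e : ∀ X, Ph (Fin.cons 1 n) X = Ph (Fin.cons (M + 1) n) X := by
    intro X
    simp [Ph]
  rw [e, e]
  apply stokes hk (Fin.cons (M + 1) n) (smp p (fun q => (H (v q) : E k))) _ _ (fun i => ind p i x)
  · intro i q c hc hq
    obtain ⟨c, rfl⟩ := Fin.exists_succ_eq.2 hc
    have hb : gpt u q ∈ Cube.boundary (Fin k) := by
      refine ⟨c, ?_⟩
      rcases hq with hq | hq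
      · left; simp [gpt, hq, h0]
      · right
        simp only [Fin.cons_succ] at hq
        simp [gpt, hq, h1]
    have : H (v q) = x := (H.eq_fst _ hb).trans (GenLoop.boundary f _ hb)
    simp only [smp, this]
  · intro s q
    by_contra hne
    rw [Ft] at hne
    replace hne := Finset.prod_ne_zero_iff.1 hne
    have : ∀ i, |crd p i (H (v q))| < δ := by
      intro i
      have h3 := hne i (Finset.mem_univ i)
      rw [Df, sub_ne_zero] at h3
      refine ind_ne h3 (hu ?_) (hu ?_)
      · rw [add_assoc]; exact hvd _ _ (pos0_st_le s i)
      · exact hvd _ _ (pos0_le s i)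
    exact absurd (crd_lt hδ this) (not_lt.2 (hH _))
  · intro i q hq
    simp only [smp, lsm, hv, hq, unif_zero]
    rw [H.apply_zero]; rfl
  · intro i q hq
    simp only [Fin.cons_zero] at hq
    simp only [smp, lsm, hv, hq, unif_self hM0]
    rw [H.apply_one]; rfl
  · intro i q m
    have : gpt u (Function.update q 0 m) = gpt u q := by
      funext c
      simp [gpt]
    simp only [smp, lsm, this]

/-- local term -/
def Tm (p : Fin k → ℝ) (S : Gv k → E k) (q : Gv k) : ℤ :=
  ∑ s : Equiv.Perm (Fin (k + 1)) with s 0 = 0, sg s * (smp p S 0 q * Wt (smp p S) s q)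

lemma Ph_eq (p : Fin k → ℝ) (S : Gv k → E k) (n : Gv k) :
    Ph n (smp p S) = ∑ q ∈ bxs (Function.update n 0 1), Tm p S q := by
  simp only [Ph, Tm, Finset.mul_sum]
  rw [Finset.sum_comm]

lemma Tm_congr (p : Fin k → ℝ) {S S' : Gv k → E k} {q q' : Gv k}
    (h : ∀ w, w ≤ 1 → S (q + w) = S' (q' + w)) : Tm p S q = Tm p S' q' := by
  refine Finset.sum_congr rfl (fun s _ => ?_)
  have h0 := h 0 (by simp)
  simp only [add_zero] at h0
  congr 2
  · simp [smp, h0]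
  · refine Finset.prod_congr rfl (fun i _ => ?_)
    simp only [Df, smp, add_assoc]
    rw [h _ (pos1_st_le s i), h _ (pos1_le s i)]

end

end UC

namespace UC

open Topology unitInterval Set Topology.Homotopy Matrix

set_option linter.unusedSectionVars false

noncomputable section

variable {k : ℕ}

lemma Df_std {m : ℕ} {p : Fin k → ℝ} {S : Gv k → E k} {q : Gv k}
    (h : ∀ w, w ≤ 1 → ∀ j : Fin k, smp p S j.succ (q + w) = if m ≤ (q + w) j.succ then 1 else 0)
    (s : Equiv.Perm (Fin (k + 1))) (j : Fin k) :
    Df (s j.succ) (smp p S j.succ) (q + pos1 s j.succ) =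
      (if m ≤ q j.succ + pos1 s j.succ j.succ + st (s j.succ) j.succ then 1 else 0) -
        (if m ≤ q j.succ + pos1 s j.succ j.succ then 1 else 0) := by
  rw [Df, add_assoc, h _ (pos1_st_le s _), h _ (pos1_le s _)]
  simp only [Pi.add_apply, add_assoc]

lemma Tm_std {m : ℕ} {p : Fin k → ℝ} {S : Gv k → E k} {q : Gv k}
    (h : ∀ w, w ≤ 1 → ∀ j : Fin k, smp p S j.succ (q + w) = if m ≤ (q + w) j.succ then 1 else 0) :
    Tm p S q = smp p S 0 q * ∏ i : Fin (k + 1) with 0 < i,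
      ((if m ≤ q i + 1 then 1 else 0) - (if m ≤ q i then 1 else 0)) := by
  rw [Tm, Finset.sum_eq_single 1]
  · have : sg (1 : Equiv.Perm (Fin (k + 1))) = 1 := by simp [sg]
    rw [this, one_mul]
    congr 1
    refine Finset.prod_congr rfl (fun i hi => ?_)
    have hi' : i ≠ 0 := by
      simp only [Finset.mem_filter, Finset.mem_univ, true_and] at hi
      exact hi.ne'
    obtain ⟨j, rfl⟩ := Fin.exists_succ_eq.2 hi'
    rw [Df_std h]
    have e : pos1 (1 : Equiv.Perm (Fin (k + 1))) j.succ j.succ = 0 := by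
      simp only [pos1, Finset.sum_apply, st]
      apply Finset.sum_eq_zero
      intro l hl
      simp only [Finset.mem_filter, Finset.mem_univ, true_and] at hl
      simp [Pi.single_apply, hl.2.ne']
    rw [e]
    simp [st]
  · intro s hs hs1
    simp only [Finset.mem_filter, Finset.mem_univ, true_and] at hs
    have : ∃ i, s i ≠ i := by
      by_contra hc
      push Not at hc
      exact hs1 (Equiv.ext hc)
    obtain ⟨i, hi⟩ := this
    have hi' : i ≠ 0 := by rintro rfl; exact hi hs
    obtain ⟨j, rfl⟩ := Fin.exists_succ_eq.2 hi'
    have : Wt (smp p S) s q = 0 := by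
      apply Finset.prod_eq_zero (i := j.succ) (by simp)
      rw [Df_std h]
      have : st (s j.succ) j.succ = 0 := by simp [st, Pi.single_apply, hi.symm]
      simp [this]
    rw [this]; simp
  · simp

lemma contr_fst_low (b : E k) {s : ℝ} (hs : s ≤ 1 / 2) (x : E k) : (contr b s x).1 = x.1 := by
  have e : max (2 * s - 1) 0 = 0 := max_eq_right (by linarith)
  simp [contr, e]

lemma contr_pos {b : E k} (hb : b.2 < 0) {s : ℝ} (hs : 0 ≤ s) {y : Fin k → ℝ}
    (h : 0 ≤ (contr b s (y, 1)).2) : 2 * s * (1 - b.2) ≤ 1 := by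
  have e0 : max (1 - b.2) 0 = 1 - b.2 := max_eq_left (by linarith)
  rcases le_or_gt (2 * s) 1 with h2 | h2
  · have e : max (2 * s - 1) 0 = 0 := max_eq_right (by linarith)
    have e2 : min (2 * s) 1 = 2 * s := min_eq_left h2
    simp [contr, e, e2, e0] at h
    linarith
  · have e2 : min (2 * s) 1 = 1 := min_eq_right h2.le
    simp only [contr, e2, e0, one_mul, Prod.snd_add, Prod.smul_snd, smul_eq_mul] at h
    have : b.2 * 1 ≥ 0 := by nlinarith
    linarith

variable {p : Fin k → ℝ} {b : E k}

lemma sep_single (p : Fin k → ℝ) : Sep ({p} : Set (Fin k → ℝ)) := by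
  rintro _ rfl _ rfl _; rfl

/-- the standard loop -/
def KK (hb : b.2 < 0) (p : Fin k → ℝ) :
    GenLoop (Fin k) (XS ({p} : Set (Fin k → ℝ))) (bp _ b hb) :=
  kap hb (stdG (sep_single p) (mem_singleton p) 1 (by simp))

lemma KK_apply (hb : b.2 < 0) (t : Fin k → I) : (KK hb p t : E k) =
    contr b (ov 1 (fun i => (t i : ℝ))) (p + gg (cen (qq 1 (fun i => (t i : ℝ)))), 1) := by
  simp [KK, kap_apply, col, stdG, stdF]

lemma KK_ind (hb : b.2 < 0) (t : Fin k → I) (h : ov 1 (fun i => (t i : ℝ)) ≤ 1 / 2) (j : Fin k) :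
    ind p j.succ (KK hb p t) = if (1 : ℝ) / 2 ≤ t j then 1 else 0 := by
  rw [ind]
  congr 1
  rw [KK_apply]
  simp only [crd, Fin.cases_succ, contr_fst_low b h, Pi.add_apply, add_sub_cancel_left, gg,
    Pi.smul_apply, smul_eq_mul]
  have := norm_nonneg (cen (qq 1 (fun i => (t i : ℝ))))
  rw [mul_nonneg_iff_of_pos_left (by positivity)]
  simp only [cen, qq, abs_one, eq_iff_iff]
  constructor
  · intro h
    by_contra hc
    push Not at hc
    have : max 0 (min 1 ((1 + 1) * ((t j : ℝ) - 1 / 2) + 1 / 2)) < 1 / 2 := by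
      apply max_lt (by norm_num)
      apply (min_le_right _ _).trans_lt; linarith
    linarith
  · intro h
    have : 1 / 2 ≤ max 0 (min 1 ((1 + 1) * ((t j : ℝ) - 1 / 2) + 1 / 2)) := by
      apply le_max_of_le_right
      apply le_min <;> linarith
    linarith

lemma KK_pos (hb : b.2 < 0) (t : Fin k → I) (h : ind p 0 (KK hb p t) ≠ 0) :
    2 * ov 1 (fun i => (t i : ℝ)) * (1 - b.2) ≤ 1 := by
  rw [ind, KK_apply] at h
  apply contr_pos hb (ov_nonneg _ _)
  by_contra hc
  rw [if_neg] at h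
  · exact h rfl
  · exact hc

lemma ov_lip (t t' : Fin k → ℝ) : ov 1 t' ≤ ov 1 t + 4 * ‖t' - t‖ := by
  simp only [ov, abs_one]
  have h1 : ‖fun i => t' i - 1 / 2‖ ≤ ‖fun i => t i - 1 / 2‖ + ‖t' - t‖ := by
    have e : (fun i => t' i - 1 / 2) = (fun i => t i - 1 / 2) + (t' - t) := by
      funext i; simp
    rw [e]; exact norm_add_le _ _
  have := norm_nonneg (t' - t)
  have h2 := le_max_left 0 ((1 + 1) * (2 * ‖fun i => t i - 1 / 2‖) - 1)
  have h3 := le_max_right 0 ((1 + 1) * (2 * ‖fun i => t i - 1 / 2‖) - 1)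
  apply max_le <;> linarith

lemma unif_coe {N j : ℕ} (hj : j ≤ N) (hN : 0 < N) : (unif N j : ℝ) = j / N := by
  have h0 : (0 : ℝ) < N := by exact_mod_cast hN
  have : (j : ℝ) / N ≤ 1 := by
    rw [div_le_one h0]; exact_mod_cast hj
  rw [unif, coe_projIcc, min_eq_right this, max_eq_right (by positivity)]

/-- sampled values of the standard loop -/
lemma KK_Tm (hb : b.2 < 0) : ∃ N0, ∀ m, N0 ≤ m →
    (∀ q : Gv k, (∀ c : Fin k, q c.succ < 2 * m) →
      0 ≤ Tm p (lsm (KK hb p) (fun _ => unif (2 * m))) q) ∧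
    0 < Tm p (lsm (KK hb p) (fun _ => unif (2 * m))) (Fin.cons 0 (fun _ => m - 1)) := by
  have hs0 : 1 / (2 * (1 - b.2)) < 1 / 2 := by
    rw [div_lt_div_iff₀ (by linarith) (by norm_num)]; linarith
  set γ : ℝ := 1 / 2 - 1 / (2 * (1 - b.2)) with hγ
  have hγ0 : 0 < γ := by linarith
  obtain ⟨M, hM⟩ := exists_nat_gt (2 / γ)
  have hkey : ∀ m, M + 4 ≤ m → ∀ q : Gv k, (∀ c : Fin k, q c.succ < 2 * m) →
      smp p (lsm (KK hb p) (fun _ => unif (2 * m))) 0 q ≠ 0 →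
      ∀ w, w ≤ 1 → ∀ j : Fin k, smp p (lsm (KK hb p) (fun _ => unif (2 * m))) j.succ (q + w) =
        if m ≤ (q + w) j.succ then 1 else 0 := by
    intro m hm q hq h0 w hw j
    have hm0 : 0 < 2 * m := by omega
    have hmr : (0 : ℝ) < m := by exact_mod_cast (by omega : 0 < m)
    have hMm : (M : ℝ) < m := by exact_mod_cast (by omega : M < m)
    have hle : ∀ c : Fin k, (q + w) c.succ ≤ 2 * m := by
      intro c
      have h1 := hq c
      have h2 := hw c.succ
      simp only [Pi.add_apply, Pi.one_apply] at h2 ⊢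
      omega
    simp only [smp, lsm] at h0 ⊢
    have h1 := KK_pos hb _ h0
    have h2 := ov_lip (fun i => ((gpt (fun _ => unif (2 * m)) q i : I) : ℝ))
      (fun i => ((gpt (fun _ => unif (2 * m)) (q + w) i : I) : ℝ))
    have h3 : ‖(fun i => ((gpt (fun _ : Fin k => unif (2 * m)) (q + w) i : I) : ℝ)) -
        (fun i => ((gpt (fun _ => unif (2 * m)) q i : I) : ℝ))‖ ≤ 1 / (2 * m) := by
      rw [pi_norm_le_iff_of_nonneg (by positivity)]
      intro c
      simp only [Pi.sub_apply, gpt]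
      rw [unif_coe (hle c) hm0, unif_coe (hq c).le hm0, ← sub_div, Real.norm_eq_abs, abs_div,
        Pi.add_apply]
      have : |((2 * m : ℕ) : ℝ)| = 2 * m := by push_cast; exact abs_of_pos (by positivity)
      rw [this]
      gcongr
      push_cast
      have h2 := hw c.succ
      have h4 : (w c.succ : ℝ) ≤ 1 := by exact_mod_cast h2
      rw [add_sub_cancel_left, abs_of_nonneg (by positivity)]
      exact h4
    have h4 : 4 * (1 / (2 * (m : ℝ))) ≤ γ := by
      have : 2 / γ < m := hM.trans hMm
      rw [div_lt_iff₀ hγ0] at this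
      have e : 4 * (1 / (2 * (m : ℝ))) = 2 / m := by field_simp; norm_num
      rw [e, div_le_iff₀ hmr]; nlinarith
    have h5 : ov 1 (fun i => ((gpt (fun _ => unif (2 * m)) q i : I) : ℝ)) ≤ 1 / (2 * (1 - b.2)) := by
      rw [le_div_iff₀ (by linarith)]; linarith
    rw [KK_ind hb _ (by linarith)]
    congr 1
    simp only [gpt]
    rw [unif_coe (hle j) hm0, div_le_div_iff₀ (by norm_num) (by exact_mod_cast hm0), eq_iff_iff]
    constructor
    · intro h
      have : 2 * m ≤ (q + w) j.succ * 2 := by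
        have h' : 1 * ((2 * m : ℕ) : ℝ) ≤ ((q + w) j.succ : ℝ) * 2 := h
        rw [one_mul] at h'
        exact_mod_cast h'
      omega
    · intro h
      have : 2 * m ≤ (q + w) j.succ * 2 := by omega
      rw [one_mul]
      exact_mod_cast this
  have hind : ∀ i x, 0 ≤ ind p i x := by
    intro i x; rw [ind]; split_ifs <;> norm_num
  refine ⟨M + 4, fun m hm => ⟨fun q hq => ?_, ?_⟩⟩
  · by_cases h0 : smp p (lsm (KK hb p) (fun _ => unif (2 * m))) 0 q = 0
    · simp [Tm, h0]
    · rw [Tm_std (hkey m hm q hq h0)]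
      apply mul_nonneg (hind _ _)
      apply Finset.prod_nonneg
      intro i _
      split_ifs <;> first | omega | norm_num
  · set q : Gv k := Fin.cons 0 (fun _ => m - 1) with hqd
    have hq : ∀ c : Fin k, q c.succ < 2 * m := by
      intro c; simp [hqd]; omega
    have h1 : smp p (lsm (KK hb p) (fun _ => unif (2 * m))) 0 q = 1 := by
      simp only [smp, lsm]
      have hmr : (4 : ℝ) ≤ m := by exact_mod_cast (by omega : 4 ≤ m)
      have ho : ov 1 (fun i => ((gpt (fun _ : Fin k => unif (2 * m)) q i : I) : ℝ)) = 0 := by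
        rw [ov]
        apply max_eq_left
        have : ‖fun i => ((gpt (fun _ : Fin k => unif (2 * m)) q i : I) : ℝ) - 1 / 2‖ ≤ 1 / 8 := by
          rw [pi_norm_le_iff_of_nonneg (by positivity)]
          intro c
          simp only [gpt]
          rw [unif_coe (hq c).le (by omega)]
          simp only [hqd, Fin.cons_succ]
          have e : (((m - 1 : ℕ) : ℝ)) / ((2 * m : ℕ) : ℝ) - 1 / 2 = - (1 / (2 * m)) := by
            rw [Nat.cast_sub (by omega)]
            push_cast
            field_simp
            ring
          rw [e, norm_neg, Real.norm_eq_abs, abs_of_pos (by positivity)]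
          apply one_div_le_one_div_of_le <;> linarith
        rw [abs_one]
        linarith
      rw [ind, KK_apply, ho, contr_zero]
      simp [crd]
    rw [Tm_std (hkey m hm q hq (by rw [h1]; norm_num)), h1, one_mul]
    apply Finset.prod_pos
    intro i hi
    have hi' : i ≠ 0 := by
      simp only [Finset.mem_filter, Finset.mem_univ, true_and] at hi
      exact hi.ne'
    obtain ⟨j, rfl⟩ := Fin.exists_succ_eq.2 hi'
    simp only [hqd, Fin.cons_succ]
    rw [if_pos (by omega), if_neg (by omega)]
    norm_num

end

end UC

namespace UC

open Topology unitInterval Set Topology.Homotopy Matrix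

set_option linter.unusedSectionVars false

noncomputable section

variable {k : ℕ} {p : Fin k → ℝ} {b : E k}

/-- left half -/
def hl (x : I) : I := ⟨(x : ℝ) / 2, by have := x.2; constructor <;> linarith [this.1, this.2]⟩

/-- right half -/
def hr (x : I) : I := ⟨(1 + (x : ℝ)) / 2, by have := x.2; constructor <;> linarith [this.1, this.2]⟩

lemma hl_dist (x y : I) : dist (hl x) (hl y) ≤ dist x y := by
  simp only [Subtype.dist_eq, Real.dist_eq, hl]
  rw [← sub_div, abs_div, abs_two]
  linarith [abs_nonneg ((x : ℝ) - y)]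

lemma hr_dist (x y : I) : dist (hr x) (hr y) ≤ dist x y := by
  simp only [Subtype.dist_eq, Real.dist_eq, hr]
  rw [← sub_div, abs_div, abs_two, add_sub_add_left_eq_sub]
  linarith [abs_nonneg ((x : ℝ) - y)]

/-- the mixed grid -/
def mg (i : Fin k) (N : ℕ) (u : ℕ → I) : Fin k → ℕ → I := fun c => if c = i then u else unif N

lemma trans_hl {X : Type*} [TopologicalSpace X] {x : X} (i : Fin k) (f g : GenLoop (Fin k) X x)
    (t : Fin k → I) (s : I) (h : t i = hl s) :
    GenLoop.transAt i f g t = f (Function.update t i s) := by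
  change (if (t i : ℝ) ≤ 1 / 2
      then f (Function.update t i <| Set.projIcc 0 1 zero_le_one (2 * t i))
      else g (Function.update t i <| Set.projIcc 0 1 zero_le_one (2 * t i - 1))) = _
  have e : (2 * (t i : ℝ)) = s := by rw [h, hl]; simp; ring
  have hs := s.2.2
  rw [if_pos (by linarith), e, projIcc_val]

lemma trans_hr {X : Type*} [TopologicalSpace X] {x : X} (i : Fin k) (f g : GenLoop (Fin k) X x)
    (t : Fin k → I) (s : I) (h : t i = hr s) :
    GenLoop.transAt i f g t = g (Function.update t i s) := by
  change (if (t i : ℝ) ≤ 1 / 2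
      then f (Function.update t i <| Set.projIcc 0 1 zero_le_one (2 * t i))
      else g (Function.update t i <| Set.projIcc 0 1 zero_le_one (2 * t i - 1))) = _
  have e : (2 * (t i : ℝ) - 1) = s := by rw [h, hr]; simp only; ring
  have e' : (2 * (t i : ℝ)) = s + 1 := by linarith
  have hs := s.2.1
  split_ifs with hc
  · have hs0 : (s : ℝ) = 0 := by linarith
    have hs0' : s = 0 := Subtype.ext hs0
    rw [e', hs0, zero_add]
    rw [GenLoop.boundary f _ ⟨i, Or.inr (by simp)⟩, GenLoop.boundary g _ ⟨i, Or.inl (by simp [hs0'])⟩]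
  · rw [e, projIcc_val]

/-- power loops -/
def pw (hb : b.2 < 0) (p : Fin k → ℝ) (i : Fin k) :
    ℕ → GenLoop (Fin k) (XS ({p} : Set (Fin k → ℝ))) (bp _ b hb)
  | 0 => KK hb p
  | n + 1 => GenLoop.transAt i (KK hb p) (pw hb p i n)

lemma lc_pw [Nonempty (Fin k)] (hb : b.2 < 0) (i : Fin k) (n : ℕ) :
    lc (pw hb p i n) = lc (KK hb p) ^ (n + 1) := by
  induction n with
  | zero => simp [pw]
  | succ n ih => rw [pw, lc_mul, ih, pow_succ _ (n + 1)]

lemma pw_grid (hb : b.2 < 0) (i : Fin k) {m : ℕ} (hm : 0 < m)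
    (h1 : ∀ q : Gv k, (∀ c : Fin k, q c.succ < 2 * m) →
      0 ≤ Tm p (lsm (KK hb p) (fun _ => unif (2 * m))) q)
    (h2 : ∃ q : Gv k, (q 0 = 0 ∧ ∀ c : Fin k, q c.succ < 2 * m) ∧
      0 < Tm p (lsm (KK hb p) (fun _ => unif (2 * m))) q) (n : ℕ) :
    ∃ (u : ℕ → I) (L : ℕ), u 0 = 0 ∧ u L = 1 ∧
      (∀ j, dist (u (j + 1)) (u j) ≤ 1 / (2 * m : ℕ)) ∧
      (∀ q : Gv k, (∀ c : Fin k, q c.succ < if c = i then L else 2 * m) →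
        0 ≤ Tm p (lsm (pw hb p i n) (mg i (2 * m) u)) q) ∧
      (∃ q : Gv k, (q 0 = 0 ∧ ∀ c : Fin k, q c.succ < if c = i then L else 2 * m) ∧
        0 < Tm p (lsm (pw hb p i n) (mg i (2 * m) u)) q) := by
  have hm0 : 0 < 2 * m := by omega
  induction n with
  | zero =>
    have e : mg i (2 * m) (unif (2 * m)) = fun _ => unif (2 * m) := by
      funext c; simp [mg]
    refine ⟨unif (2 * m), 2 * m, unif_zero _, unif_self hm0, unif_dist hm0, ?_, ?_⟩
    · intro q hq
      rw [e]; exact h1 q (fun c => by simpa using hq c)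
    · obtain ⟨q, hq, hq'⟩ := h2
      exact ⟨q, by simpa using hq, by rw [e]; exact hq'⟩
  | succ n ih =>
    obtain ⟨u, L, u0, uL, hd, hpos, -⟩ := ih
    set N := 2 * m with hN
    set u' : ℕ → I := fun j => if j ≤ N then hl (unif N j) else hr (u (j - N)) with hu'
    have ua : ∀ j, j ≤ N → u' j = hl (unif N j) := fun j hj => by simp [hu', hj]
    have ub : ∀ j, N ≤ j → u' j = hr (u (j - N)) := by
      intro j hj
      rcases hj.eq_or_lt with e | e
      · subst e
        rw [ua _ le_rfl, unif_self hm0]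
        simp [u0, hl, hr]
      · simp [hu', e]
    have hA : ∀ q : Gv k, q i.succ ≤ N →
        lsm (pw hb p i (n + 1)) (mg i N u') q = lsm (KK hb p) (fun _ => unif N) q := by
      intro q hq
      simp only [lsm, pw]
      rw [trans_hl i _ _ _ (unif N (q i.succ)) (by simp [gpt, mg, ua _ hq])]
      congr 2
      funext c
      by_cases e : c = i
      · subst e; simp [gpt]
      · simp [e, gpt, mg]
    have hB : ∀ q q' : Gv k, (∀ c : Fin k, c ≠ i → q' c.succ = q c.succ) → q i.succ = q' i.succ + N →
        lsm (pw hb p i (n + 1)) (mg i N u') q = lsm (pw hb p i n) (mg i N u) q' := by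
      intro q q' hqq hq
      simp only [lsm, pw]
      rw [trans_hr i _ _ _ (u (q' i.succ)) (by simp only [gpt, mg, if_true, ub _ (by omega : N ≤ q i.succ)]; simp [hq])]
      congr 2
      funext c
      by_cases e : c = i
      · subst e; simp [gpt, mg]
      · simp [e, gpt, mg, hqq c e]
    have hA' : ∀ q : Gv k, q i.succ < N → Tm p (lsm (pw hb p i (n + 1)) (mg i N u')) q =
        Tm p (lsm (KK hb p) (fun _ => unif N)) q := by
      intro q hq
      apply Tm_congr
      intro w hw
      apply hA
      have := hw i.succ
      simp only [Pi.add_apply, Pi.one_apply] at this ⊢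
      omega
    refine ⟨u', N + L, ?_, ?_, ?_, ?_, ?_⟩
    · rw [ua 0 (by omega), unif_zero]; simp [hl]
    · rw [ub _ (by omega)]; simp [uL, hr]
    · intro j
      rcases lt_or_ge j N with hj | hj
      · rw [ua _ hj, ua _ hj.le]
        exact (hl_dist _ _).trans (unif_dist hm0 j)
      · rw [ub _ hj, ub _ (by omega), Nat.sub_add_comm hj]
        exact (hr_dist _ _).trans (hd _)
    · intro q hq
      rcases lt_or_ge (q i.succ) N with hj | hj
      · rw [hA' q hj]
        apply h1
        intro c
        by_cases e : c = i
        · subst e; exact hj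
        · simpa [e] using hq c
      · set q' : Gv k := Function.update q i.succ (q i.succ - N) with hq'
        have e : Tm p (lsm (pw hb p i (n + 1)) (mg i N u')) q =
            Tm p (lsm (pw hb p i n) (mg i N u)) q' := by
          apply Tm_congr
          intro w hw
          apply hB
          · intro c hc
            simp [hq', hc]
          · simp [hq']; omega
        rw [e]
        apply hpos
        intro c
        by_cases e : c = i
        · subst e
          have := hq c
          simp [hq'] at this ⊢
          omega
        · simpa [e, hq'] using hq c
    · obtain ⟨q, hq, hq'⟩ := h2
      refine ⟨q, ⟨hq.1, fun c => ?_⟩, ?_⟩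
      · have := hq.2 c
        split_ifs <;> omega
      · rw [hA' q (hq.2 i)]; exact hq'

lemma Ph_const (hk : 0 < k) {x : XS ({p} : Set (Fin k → ℝ))} (u : Fin k → ℕ → I) (n : Gv k) :
    Ph n (smp p (lsm (GenLoop.const : GenLoop (Fin k) _ x) u)) = 0 := by
  rw [Ph_eq]
  apply Finset.sum_eq_zero
  intro q _
  apply Finset.sum_eq_zero
  intro s _
  have : Wt (smp p (lsm (GenLoop.const : GenLoop (Fin k) _ x) u)) s q = 0 := by
    apply Finset.prod_eq_zero (i := (⟨0, hk⟩ : Fin k).succ)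
      (by simp only [Finset.mem_filter, Finset.mem_univ, true_and]; exact Fin.succ_pos _)
    simp [Df, smp, lsm]
  rw [this]; simp

theorem KK_pow_ne [Nonempty (Fin k)] (hk : 0 < k) (hb : b.2 < 0) (p : Fin k → ℝ) (n : ℕ) :
    lc (KK hb p) ^ (n + 1) ≠ 1 := by
  intro h
  have i : Fin k := ⟨0, hk⟩
  rw [← lc_pw hb i, ← lc_one] at h
  have h' : GenLoop.Homotopic (pw hb p i n) GenLoop.const := Quotient.exact h
  obtain ⟨η, hη, hP⟩ := Ph_homotopic hk h'
  obtain ⟨N0, hN0⟩ := KK_Tm (p := p) hb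
  obtain ⟨M, hM⟩ := exists_nat_one_div_lt hη
  set m := N0 + M + 1 with hm
  obtain ⟨h1, h2⟩ := hN0 m (by omega)
  obtain ⟨u, L, u0, uL, hd, hpos, q, hq, hq'⟩ := pw_grid hb i (m := m) (by omega) h1
    ⟨_, ⟨by simp, fun c => by simp; omega⟩, h2⟩ n
  have hm0 : 0 < 2 * m := by omega
  have hlt : 1 / ((2 * m : ℕ) : ℝ) < η := by
    refine lt_of_le_of_lt ?_ hM
    apply one_div_le_one_div_of_le (by positivity)
    have : M + 1 ≤ 2 * m := by omega
    exact_mod_cast this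
  have hfin := hP (mg i (2 * m) u) (fun c => if c = i then L else 2 * m) ?_ ?_ ?_
  · rw [Ph_const hk, Ph_eq] at hfin
    have hpos' : 0 < ∑ q ∈ bxs (Function.update (Fin.cons 1 (fun c => if c = i then L else 2 * m) : Gv k) 0 1),
        Tm p (lsm (pw hb p i n) (mg i (2 * m) u)) q := by
      apply Finset.sum_pos'
      · intro q hq
        apply hpos
        intro c
        simpa using mem_bxs.1 hq c.succ
      · refine ⟨q, ?_, hq'⟩
        rw [mem_bxs]
        intro c
        refine Fin.cases ?_ (fun c => ?_) c
        · simp [hq.1]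
        · simpa using hq.2 c
    omega
  · intro c
    by_cases e : c = i
    · simp [mg, e, u0]
    · simp [mg, e, unif_zero]
  · intro c
    by_cases e : c = i
    · simp [mg, e, uL]
    · simp [mg, e, unif_self hm0]
  · intro c j
    by_cases e : c = i
    · simp only [mg, e, if_true]; exact (hd j).trans_lt hlt
    · simp only [mg, e, if_false]; exact (unif_dist hm0 j).trans_lt hlt

end

end UC

namespace UC

open Topology unitInterval Set Topology.Homotopy Matrix

set_option linter.unusedSectionVars false

noncomputable section

section Induced

variable {N : Type} [Fintype N] [DecidableEq N] {X Y : Type*} [TopologicalSpace X] [TopologicalSpace Y]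

/-- pushforward of loops -/
def mapL (φ : C(X, Y)) {x : X} {y : Y} (h : φ x = y) (f : GenLoop N X x) : GenLoop N Y y :=
  ⟨φ.comp f.1, fun t ht => by
    change φ (f t) = y
    rw [GenLoop.boundary f t ht, h]⟩

lemma mapL_apply (φ : C(X, Y)) {x : X} {y : Y} (h : φ x = y) (f : GenLoop N X x) (t : N → I) :
    mapL φ h f t = φ (f t) := rfl

lemma mapL_trans (φ : C(X, Y)) {x : X} {y : Y} (h : φ x = y) (i : N) (f g : GenLoop N X x) :
    mapL φ h (GenLoop.transAt i f g) = GenLoop.transAt i (mapL φ h f) (mapL φ h g) := by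
  ext t
  exact apply_ite φ _ _ _

/-- induced map on homotopy groups -/
def mapQ (φ : C(X, Y)) {x : X} {y : Y} (h : φ x = y) : HomotopyGroup N X x → HomotopyGroup N Y y :=
  Quotient.map (mapL φ h) (fun _ _ hfg => Nonempty.map (fun H => H.compContinuousMap φ) hfg)

lemma mapQ_lc (φ : C(X, Y)) {x : X} {y : Y} (h : φ x = y) (f : GenLoop N X x) :
    mapQ φ h (lc f) = lc (mapL φ h f) := rfl

lemma exists_lc {x : X} (a : HomotopyGroup N X x) : ∃ f : GenLoop N X x, a = lc f := by
  induction a using Quotient.inductionOn with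
  | _ f => exact ⟨f, rfl⟩

/-- induced homomorphism -/
def mapH [Nonempty N] (φ : C(X, Y)) {x : X} {y : Y} (h : φ x = y) :
    HomotopyGroup N X x →* HomotopyGroup N Y y where
  toFun := mapQ φ h
  map_one' := by
    rw [← lc_one, mapQ_lc, ← lc_one]
    congr 1
    ext t
    exact h
  map_mul' := by
    intro a c
    obtain ⟨f, rfl⟩ := exists_lc a
    obtain ⟨g, rfl⟩ := exists_lc c
    have i : N := Classical.arbitrary N
    rw [← lc_mul i, mapQ_lc, mapL_trans, lc_mul, mapQ_lc, mapQ_lc]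

lemma mapH_lc [Nonempty N] (φ : C(X, Y)) {x : X} {y : Y} (h : φ x = y) (f : GenLoop N X x) :
    mapH φ h (lc f) = lc (mapL φ h f) := rfl

end Induced

variable {k : ℕ} {P : Set (Fin k → ℝ)} {b : E k}

/-- forgetting all punctures but one -/
def inc {p : Fin k → ℝ} (hp : p ∈ P) : C(XS P, XS ({p} : Set (Fin k → ℝ))) :=
  ⟨fun x => ⟨x, fun h => x.2 (by rw [mem_singleton_iff.1 h]; exact hp)⟩, by fun_prop⟩

lemma inc_bp (hb : b.2 < 0) {p : Fin k → ℝ} (hp : p ∈ P) : inc hp (bp P b hb) = bp {p} b hb := rfl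

lemma inc_gen [Nonempty (Fin k)] (hb : b.2 < 0) (hP : Sep P) {p : Fin k → ℝ} (hp : p ∈ P) :
    mapH (inc hp) (inc_bp hb hp) (gen hb hP hp) = lc (KK hb p) := rfl

lemma inc_gen_ne [Nonempty (Fin k)] (hb : b.2 < 0) (hP : Sep P) {p p' : Fin k → ℝ} (hp : p ∈ P)
    (hp' : p' ∈ P) (hne : p ≠ p') :
    mapH (inc hp) (inc_bp hb hp) (gen hb hP hp') = 1 := by
  have hV : ∀ t, stdF p' 1 t ∈ VS ({p} : Set (Fin k → ℝ)) := by
    intro t h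
    exfalso
    apply hne
    apply hP p' hp' p hp
    have : p = p' + gg (1 *ᵥ cen t) := (mem_singleton_iff.1 h).symm
    rw [this, add_sub_cancel_left]
    exact gg_norm _
  let G : GM ({p} : Set (Fin k → ℝ)) (Fin k) := ⟨stdF p' 1, (stdG hP hp' 1 (by simp)).cont,
    ⟨fun t _ => VS_sub_XS _ (hV t), fun t _ _ => hV t⟩⟩
  have e : mapH (inc hp) (inc_bp hb hp) (gen hb hP hp') = cls hb G := rfl
  rw [e, cls_of_VS hb G (fun t _ => hV t), lc_one]

lemma group_free {G : Type} [Group G] (hc : ∀ a c : G, a * c = c * a) (e : ℤ → G)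
    (hgen : Subgroup.closure (range e) = ⊤)
    (hom : ∀ m, ∃ (H : Type) (_ : CommGroup H) (φ : G →* H), (∀ n : ℕ, φ (e m) ^ (n + 1) ≠ 1) ∧
      ∀ m', m ≠ m' → φ (e m') = 1) : Nonempty (G ≃* Multiplicative (ℕ →₀ ℤ)) := by
  letI : CommGroup G := { ‹Group G› with mul_comm := hc }
  let v : ℤ → Additive G := fun m => Additive.ofMul (e m)
  have hli : LinearIndependent ℤ v := by
    rw [linearIndependent_iff']
    intro s g hg m hm
    have h1 : ∏ i ∈ s, e i ^ (g i) = 1 := by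
      have := congrArg Additive.toMul hg
      simpa [v, toMul_sum] using this
    obtain ⟨H, _, φ, ha, hb⟩ := hom m
    have h2 : φ (e m) ^ (g m) = 1 := by
      have h3 := congrArg φ h1
      rw [map_prod, map_one, Finset.prod_eq_single m] at h3
      · simpa using h3
      · intro m' _ hm'
        simp [hb m' hm'.symm]
      · intro h; exact absurd hm h
    by_contra hne
    rcases lt_or_gt_of_ne hne with h | h
    · apply ha ((-(g m)).toNat - 1)
      have e2 : (((-(g m)).toNat - 1 + 1 : ℕ) : ℤ) = -(g m) := by omega
      rw [← zpow_natCast, e2, _root_.zpow_neg, h2, inv_one]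
    · apply ha ((g m).toNat - 1)
      have e2 : (((g m).toNat - 1 + 1 : ℕ) : ℤ) = g m := by omega
      rw [← zpow_natCast, e2, h2]
  have hsp : ⊤ ≤ Submodule.span ℤ (range v) := by
    rintro x -
    have hx : Additive.toMul x ∈ Subgroup.closure (range e) := by rw [hgen]; trivial
    have : ∀ y ∈ Subgroup.closure (range e), Additive.ofMul y ∈ Submodule.span ℤ (range v) := by
      intro y hy
      induction hy using Subgroup.closure_induction with
      | mem y hy =>
        obtain ⟨m, rfl⟩ := hy
        exact Submodule.subset_span ⟨m, rfl⟩
      | one => exact Submodule.zero_mem _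
      | mul a c _ _ ha hc => exact Submodule.add_mem _ ha hc
      | inv a _ ha => exact Submodule.neg_mem _ ha
    exact this _ hx
  have B := Module.Basis.mk hli hsp
  have e1 := (B.repr.trans (Finsupp.domLCongr Equiv.intEquivNat)).toAddEquiv
  exact ⟨AddEquiv.toMultiplicativeRight e1⟩

lemma pi_comm [Nontrivial (Fin k)] {X : Type} [TopologicalSpace X] {x : X}
    (a c : HomotopyGroup (Fin k) X x) : a * c = c * a :=
  (HomotopyGroup.commGroup (N := Fin k) (X := X) (x := x)).mul_comm a c

theorem pi_iso [Nonempty (Fin k)] (hk : 2 ≤ k) (hb : b.2 < 0) (hP : Sep P) (hPcl : IsClosed P)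
    (pt : ℤ → Fin k → ℝ) (hinj : Function.Injective pt) (hr : P = range pt) :
    Nonempty (HomotopyGroup (Fin k) (XS P) (bp P b hb) ≃* Multiplicative (ℕ →₀ ℤ)) := by
  haveI : Nontrivial (Fin k) := Fin.nontrivial_iff_two_le.2 hk
  have hPc : P.Countable := by rw [hr]; exact countable_range pt
  have hmem : ∀ m, pt m ∈ P := fun m => by rw [hr]; exact mem_range_self m
  refine group_free (fun a c => pi_comm a c) (fun m => gen hb hP (hmem m)) ?_ ?_
  · rw [← genSub_eq_top hPcl hPc hb hP, genSub]
    congr 1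
    ext x
    constructor
    · rintro ⟨m, rfl⟩
      exact ⟨_, hmem m, rfl⟩
    · rintro ⟨q, hq, rfl⟩
      have hq' := hq
      rw [hr] at hq'
      obtain ⟨m, rfl⟩ := hq'
      exact ⟨m, rfl⟩
  · intro m
    refine ⟨HomotopyGroup (Fin k) (XS ({pt m} : Set (Fin k → ℝ))) (bp {pt m} b hb),
      { HomotopyGroup.group (Fin k) with mul_comm := fun a c => pi_comm a c },
      mapH (inc (hmem m)) (inc_bp hb (hmem m)), ?_, ?_⟩
    · intro n
      exact KK_pow_ne (by omega) hb (pt m) n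
    · intro m' hm'
      exact inc_gen_ne hb hP (hmem m) (hmem m') (fun h => hm' (hinj h))

end

end UC

namespace UC

open Topology unitInterval Set Topology.Homotopy Matrix

set_option linter.unusedSectionVars false

noncomputable section

section SC

variable {k : ℕ} {P : Set (Fin k → ℝ)}

lemma sub_pi (hP : IsClosed P) (hPc : P.Countable) {b : E k} (hb : b.2 < 0)
    {N : Type} [Fintype N] [DecidableEq N] (hN : Fintype.card N < k) :
    Subsingleton (HomotopyGroup N (XS P) (bp P b hb)) := by
  refine ⟨fun a c => ?_⟩
  obtain ⟨f, rfl⟩ := exists_lc a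
  obtain ⟨g, rfl⟩ := exists_lc c
  rw [lc_trivial hP hPc hb hN f, lc_trivial hP hPc hb hN g]

lemma XS_sc (hk : 2 ≤ k) (hP : IsClosed P) (hPc : P.Countable) : SimplyConnectedSpace (XS P) := by
  set b : E k := (0, -1) with hbdef
  have hb : b.2 < 0 := by simp [hbdef]
  have h0 : Subsingleton (ZerothHomotopy (XS P)) := by
    have := sub_pi hP hPc hb (N := Fin 0) (by simp; omega)
    exact (HomotopyGroup.pi0EquivZerothHomotopy (X := XS P) (x := bp P b hb)).symm.subsingleton
  have hpc : PathConnectedSpace (XS P) :=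
    pathConnectedSpace_iff_zerothHomotopy.2 ⟨⟨Quotient.mk _ (bp P b hb)⟩, h0⟩
  have h1 : Subsingleton (FundamentalGroup (XS P) (bp P b hb)) := by
    have := sub_pi hP hPc hb (N := Fin 1) (by simp; omega)
    exact (HomotopyGroup.pi1EquivFundamentalGroup (X := XS P) (x := bp P b hb)).symm.subsingleton
  refine simply_connected_iff_loops_nullhomotopic.2 ⟨hpc, fun x γ => ?_⟩
  have h2 : Subsingleton (FundamentalGroup (XS P) x) :=
    (FundamentalGroup.fundamentalGroupMulEquivOfPathConnected x (bp P b hb)).toEquiv.subsingleton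
  have h3 : FundamentalGroup.fromPath (Path.Homotopic.Quotient.mk γ) =
    FundamentalGroup.fromPath (Path.Homotopic.Quotient.mk (Path.refl x)) := Subsingleton.elim _ _
  have h4 : (Path.Homotopic.Quotient.mk γ) = (Path.Homotopic.Quotient.mk (Path.refl x)) := h3
  exact Quotient.exact h4

end SC

section PE

variable {N : Type} [Fintype N] [DecidableEq N] [Nonempty N]
variable {X Y : Type} [TopologicalSpace X] [TopologicalSpace Y]

lemma lc_map_of_rel (φ : C(X, X)) {x : X} (h : φ x = x)
    (H : φ.HomotopicRel (ContinuousMap.id X) {x}) (f : GenLoop N X x) : lc (mapL φ h f) = lc f := by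
  obtain ⟨H⟩ := H
  refine Quotient.sound ⟨?_⟩
  refine ⟨⟨⟨fun p => H (p.1, f p.2), by fun_prop⟩, ?_, ?_⟩, ?_⟩
  · intro t
    exact H.apply_zero (f t)
  · intro t
    exact H.apply_one (f t)
  · intro s t ht
    have e : f t = x := GenLoop.boundary f _ ht
    have := H.eq_fst s (x := x) rfl
    change H (s, f t) = φ (f t)
    rw [e, this]

lemma mapL_comp {Z : Type} [TopologicalSpace Z] (φ : C(X, Y)) (ψ : C(Y, Z)) {x : X} {y : Y} {z : Z}
    (h : φ x = y) (h' : ψ y = z) (f : GenLoop N X x) :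
    mapL ψ h' (mapL φ h f) = mapL (ψ.comp φ) (by simp [h, h']) f := rfl

/-- Based homotopy equivalences induce isomorphisms on homotopy groups. -/
def pi_equiv (F : C(X, Y)) (G : C(Y, X)) {x : X} {y : Y} (hF : F x = y) (hG : G y = x)
    (h1 : (G.comp F).HomotopicRel (ContinuousMap.id X) {x})
    (h2 : (F.comp G).HomotopicRel (ContinuousMap.id Y) {y}) :
    HomotopyGroup N X x ≃* HomotopyGroup N Y y where
  toFun := mapH F hF
  invFun := mapH G hG
  left_inv a := by
    obtain ⟨f, rfl⟩ := exists_lc a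
    rw [mapH_lc, mapH_lc, mapL_comp]
    exact lc_map_of_rel _ _ h1 f
  right_inv a := by
    obtain ⟨f, rfl⟩ := exists_lc a
    rw [mapH_lc, mapH_lc, mapL_comp]
    exact lc_map_of_rel _ _ h2 f
  map_mul' := map_mul _

end PE

section PZ

variable {k : ℕ}

/-- The punctures on the first coordinate axis. -/
def pz (i : Fin k) (m : ℤ) : Fin k → ℝ := Pi.single i (m : ℝ)

lemma pz_inj (i : Fin k) : Function.Injective (pz i) := by
  intro m m' h
  have := congrFun h i
  simpa [pz] using this

lemma pz_sep (i : Fin k) : Sep (range (pz i)) := by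
  rintro _ ⟨m, rfl⟩ _ ⟨m', rfl⟩ h
  have h1 : ‖(pz i m' - pz i m) i‖ < 1 := (norm_le_pi_norm _ i).trans_lt h
  simp only [pz, Pi.sub_apply, Pi.single_eq_same, Real.norm_eq_abs] at h1
  have h2 : |m' - m| < 1 := by exact_mod_cast h1
  have : m' = m := by
    have := Int.abs_lt_one_iff.1 h2; omega
  rw [this]

lemma pz_mem (i : Fin k) (y : Fin k → ℝ) :
    y ∈ range (pz i) ↔ (∃ m : ℤ, (m : ℝ) = y i) ∧ ∀ j, j ≠ i → y j = 0 := by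
  constructor
  · rintro ⟨m, rfl⟩
    exact ⟨⟨m, by simp [pz]⟩, fun j hj => by simp [pz, hj]⟩
  · rintro ⟨⟨m, hm⟩, h⟩
    refine ⟨m, ?_⟩
    ext j
    by_cases hj : j = i
    · subst hj; simp [pz, hm]
    · simp [pz, hj, h j hj]

lemma pz_closed (i : Fin k) : IsClosed (range (pz i)) := by
  have : range (pz i) = (fun y : Fin k → ℝ => y i) ⁻¹' (range ((↑) : ℤ → ℝ)) ∩
      ⋂ j, ⋂ (_ : j ≠ i), {y | y j = 0} := by
    ext y
    rw [pz_mem]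
    simp
  rw [this]
  refine (Int.isClosedEmbedding_coe_real.isClosed_range.preimage (continuous_apply i)).inter ?_
  refine isClosed_iInter fun j => isClosed_iInter fun _ => ?_
  exact isClosed_eq (continuous_apply j) continuous_const

lemma XS_pz_sc (hk : 2 ≤ k) (i : Fin k) : SimplyConnectedSpace (XS (range (pz i))) :=
  XS_sc hk (pz_closed i) (countable_range _)

lemma XS_pz_pi [Nonempty (Fin k)] (hk : 2 ≤ k) (i : Fin k) (x : XS (range (pz i)))
    (hx : x.1.2 < 0) :
    Nonempty (HomotopyGroup (Fin k) (XS (range (pz i))) x ≃* Multiplicative (ℕ →₀ ℤ)) :=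
  pi_iso (b := x.1) hk hx (pz_sep i) (pz_closed i) (pz i) (pz_inj i) rfl

end PZ

end

end UC

namespace UC

open Topology unitInterval Set Topology.Homotopy Matrix

set_option linter.unusedSectionVars false

noncomputable section

section Homeos

variable {X Y : Type} [TopologicalSpace X] [TopologicalSpace Y]

/-- homeomorphisms induce isomorphisms -/
def pi_homeo {N : Type} [Fintype N] [DecidableEq N] [Nonempty N] (e : X ≃ₜ Y) (x : X) :
    HomotopyGroup N X x ≃* HomotopyGroup N Y (e x) :=
  pi_equiv (⟨e, e.continuous⟩ : C(X, Y)) ⟨e.symm, e.symm.continuous⟩ rfl (e.symm_apply_apply x)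
    (by
      have : (ContinuousMap.comp (⟨e.symm, e.symm.continuous⟩ : C(Y, X)) ⟨e, e.continuous⟩) =
        ContinuousMap.id X := by ext; simp
      rw [this]; exact .refl _)
    (by
      have : (ContinuousMap.comp (⟨e, e.continuous⟩ : C(X, Y)) ⟨e.symm, e.symm.continuous⟩) =
        ContinuousMap.id Y := by ext; simp
      rw [this]; exact .refl _)

/-- Complement of the integer points on a line. -/
abbrev XL (k : ℕ) : Type := {x : ℝ × EuclideanSpace ℝ (Fin k) // ∀ m : ℤ, x ≠ ((m : ℝ), 0)}

variable {k : ℕ}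

lemma XL_iff (x : ℝ × EuclideanSpace ℝ (Fin k)) :
    (∀ m : ℤ, x ≠ ((m : ℝ), 0)) ↔ (x.2 = 0 → ∀ m : ℤ, x.1 ≠ m) := by
  simp only [ne_eq, Prod.ext_iff]
  tauto

lemma sin_pi_int (m : ℤ) : Real.sin (Real.pi * m) = 0 := by
  rw [mul_comm]; exact Real.sin_int_mul_pi m

lemma bump_ok (w : EuclideanSpace ℝ (Fin k)) (x : ℝ × EuclideanSpace ℝ (Fin k))
    (h : ∀ m : ℤ, x ≠ ((m : ℝ), 0)) (m : ℤ) :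
    (x.1, x.2 + Real.sin (Real.pi * x.1) • w) ≠ ((m : ℝ), (0 : EuclideanSpace ℝ (Fin k))) := by
  intro e
  rw [Prod.ext_iff] at e
  obtain ⟨e1, e2⟩ := e
  simp only at e1 e2
  rw [e1, sin_pi_int, zero_smul, add_zero] at e2
  exact h m (Prod.ext e1 e2)

/-- shear in the direction of `w`, fixing the integer points -/
def bump (w : EuclideanSpace ℝ (Fin k)) : XL k ≃ₜ XL k where
  toFun x := ⟨(x.1.1, x.1.2 + Real.sin (Real.pi * x.1.1) • w), bump_ok w x.1 x.2⟩
  invFun x := ⟨(x.1.1, x.1.2 + Real.sin (Real.pi * x.1.1) • (-w)), bump_ok (-w) x.1 x.2⟩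
  left_inv x := by ext <;> simp
  right_inv x := by ext <;> simp
  continuous_toFun := by fun_prop
  continuous_invFun := by fun_prop

/-- move to the standard model -/
def toXS (i : Fin k) (ε : ℝ) (hε : ε * ε = 1) : XL k ≃ₜ XS (range (pz i)) where
  toFun x := ⟨(Function.update (WithLp.ofLp x.1.2) i x.1.1, ε * x.1.2 i), by
    intro h h0
    simp only at h h0
    rw [pz_mem] at h
    obtain ⟨⟨m, hm⟩, h⟩ := h
    have hε0 : ε ≠ 0 := by rintro rfl; simp at hε
    have h1 : x.1.2 i = 0 := by simpa [hε0] using h0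
    refine x.2 m (Prod.ext ?_ ?_)
    · simpa using hm.symm
    · ext j
      by_cases hj : j = i
      · subst hj; simpa using h1
      · simpa [hj] using h j hj⟩
  invFun y := ⟨(y.1.1 i, WithLp.toLp 2 (Function.update y.1.1 i (ε * y.1.2))), by
    intro m h
    rw [Prod.ext_iff] at h
    obtain ⟨h1, h2⟩ := h
    simp only at h1 h2
    have hε0 : ε ≠ 0 := by rintro rfl; simp at hε
    have h3 : ∀ j, Function.update y.1.1 i (ε * y.1.2) j = 0 := fun j => by
      have := congrArg (fun v : EuclideanSpace ℝ (Fin k) => v j) h2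
      simpa using this
    refine y.2 ?_ ?_
    · rw [pz_mem]
      refine ⟨⟨m, h1.symm⟩, fun j hj => by simpa [hj] using h3 j⟩
    · simpa [hε0] using h3 i⟩
  left_inv x := by
    ext j
    · simp
    · by_cases hj : j = i
      · subst hj; simp [← mul_assoc, hε]
      · simp [hj]
  right_inv x := by
    ext j
    · by_cases hj : j = i
      · subst hj; simp
      · simp [hj]
    · simp [← mul_assoc, hε]
  continuous_toFun := by fun_prop
  continuous_invFun := by fun_prop

lemma XL_sc (hk : 2 ≤ k) : SimplyConnectedSpace (XL k) := by
  have i : Fin k := ⟨0, by omega⟩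
  have := XS_pz_sc hk i
  exact (toXS i 1 (by norm_num)).toHomotopyEquiv.simplyConnectedSpace

lemma XL_pi_aux [Nonempty (Fin k)] (hk : 2 ≤ k) (x : XL k) (hx : x.1.2 ≠ 0) :
    Nonempty (HomotopyGroup (Fin k) (XL k) x ≃* Multiplicative (ℕ →₀ ℤ)) := by
  obtain ⟨i, hi⟩ : ∃ i, x.1.2 i ≠ 0 := by
    by_contra! h
    exact hx (by ext j; simpa using h j)
  obtain ⟨ε, hε, hlt⟩ : ∃ ε : ℝ, ε * ε = 1 ∧ ε * x.1.2 i < 0 := by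
    rcases lt_or_gt_of_ne hi with h | h
    · exact ⟨1, by norm_num, by linarith⟩
    · exact ⟨-1, by norm_num, by linarith⟩
  obtain ⟨e⟩ := XS_pz_pi hk i (toXS i ε hε x) hlt
  exact ⟨(pi_homeo (toXS i ε hε) x).trans e⟩

lemma XL_pi [Nonempty (Fin k)] (hk : 2 ≤ k) (x : XL k) :
    Nonempty (HomotopyGroup (Fin k) (XL k) x ≃* Multiplicative (ℕ →₀ ℤ)) := by
  by_cases hx : x.1.2 = 0
  · let w : EuclideanSpace ℝ (Fin k) := EuclideanSpace.single ⟨0, by omega⟩ 1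
    have hw : w ≠ 0 := by simp [w]
    have hs : Real.sin (Real.pi * x.1.1) ≠ 0 := by
      intro h
      rw [Real.sin_eq_zero_iff] at h
      obtain ⟨m, hm⟩ := h
      have : x.1.1 = m := by
        have := Real.pi_pos.ne'
        rw [mul_comm] at hm
        exact (mul_left_cancel₀ this hm).symm
      exact x.2 m (Prod.ext this hx)
    obtain ⟨e⟩ := XL_pi_aux hk (bump w x) (by
      change x.1.2 + Real.sin (Real.pi * x.1.1) • w ≠ 0
      rw [hx, zero_add]
      exact smul_ne_zero hs hw)
    exact ⟨(pi_homeo (bump w) x).trans e⟩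
  · exact XL_pi_aux hk x hx

end Homeos

section Conf

variable {n : ℕ}

/-- rescaling factor -/
def rr (c v : EuclideanSpace ℝ (Fin (n - 1))) : ℝ := (max 1 (max ‖c - (2⁻¹ : ℝ) • v‖ ‖c + (2⁻¹ : ℝ) • v‖))⁻¹

lemma rr_den (c v : EuclideanSpace ℝ (Fin (n - 1))) : 1 ≤ max 1 (max ‖c - (2⁻¹ : ℝ) • v‖ ‖c + (2⁻¹ : ℝ) • v‖) := le_max_left _ _

lemma rr_pos (c v : EuclideanSpace ℝ (Fin (n - 1))) : 0 < rr c v := inv_pos.2 (zero_lt_one.trans_le (rr_den c v))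

lemma rr_cont (c : EuclideanSpace ℝ (Fin (n - 1))) : Continuous (rr c) := by
  unfold rr
  refine Continuous.inv₀ (by fun_prop) fun v => ?_
  exact (zero_lt_one.trans_le (rr_den c v)).ne'

lemma rr_sub (c v : EuclideanSpace ℝ (Fin (n - 1))) : ‖rr c v • (c - (2⁻¹ : ℝ) • v)‖ ≤ 1 := by
  rw [norm_smul, Real.norm_of_nonneg (rr_pos c v).le, rr, inv_mul_le_one₀ (zero_lt_one.trans_le (rr_den c v))]
  exact (le_max_left _ _).trans (le_max_right _ _)

lemma rr_add (c v : EuclideanSpace ℝ (Fin (n - 1))) : ‖rr c v • (c + (2⁻¹ : ℝ) • v)‖ ≤ 1 := by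
  rw [norm_smul, Real.norm_of_nonneg (rr_pos c v).le, rr, inv_mul_le_one₀ (zero_lt_one.trans_le (rr_den c v))]
  exact (le_max_right _ _).trans (le_max_right _ _)

lemma rr_one (c v : EuclideanSpace ℝ (Fin (n - 1))) (h1 : ‖c - (2⁻¹ : ℝ) • v‖ ≤ 1) (h2 : ‖c + (2⁻¹ : ℝ) • v‖ ≤ 1) : rr c v = 1 := by
  rw [rr, max_eq_left (max_le h1 h2), inv_one]

lemma conf_of {s₁ s₂ s₁' s₂' : ℝ} {x₁ x₂ x₁' x₂' : Dball (n - 1)}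
    (h : ∀ m : ℤ, ((s₂, x₂) : ℝ × Dball (n - 1)) ≠ (s₁ + (m : ℝ), x₁)) {r : ℝ} (hr : 0 < r)
    (hs : s₂' - s₁' = s₂ - s₁) (hx : x₂'.1 - x₁'.1 = r • (x₂.1 - x₁.1)) (m : ℤ) :
    ((s₂', x₂') : ℝ × Dball (n - 1)) ≠ (s₁' + (m : ℝ), x₁') := by
  intro e
  rw [Prod.ext_iff] at e
  obtain ⟨e1, e2⟩ := e
  simp only at e1 e2
  rw [e2, sub_self] at hx
  have h0 := (smul_eq_zero.1 hx.symm).resolve_left hr.ne'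
  exact h m (Prod.ext (by simp only; linarith) (Subtype.ext (sub_eq_zero.1 h0)))

/-- difference map -/
def PhiC : C(UnivCoverConf2 n, XL (n - 1)) where
  toFun q := ⟨(q.1.2.1 - q.1.1.1, q.1.2.2.1 - q.1.1.2.1), by
    intro m e
    rw [Prod.ext_iff] at e
    obtain ⟨e1, e2⟩ := e
    simp only at e1 e2
    exact q.2 m (Prod.ext (by simp only; linarith) (Subtype.ext (sub_eq_zero.1 e2)))⟩
  continuous_toFun := by fun_prop

lemma psi_diff (r : ℝ) (c v : EuclideanSpace ℝ (Fin (n - 1))) :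
    r • (c + (2⁻¹ : ℝ) • v) - r • (c - (2⁻¹ : ℝ) • v) = r • v := by
  module

/-- inverse of the difference map up to homotopy -/
def PsiC (a : ℝ) (c : EuclideanSpace ℝ (Fin (n - 1))) : C(XL (n - 1), UnivCoverConf2 n) where
  toFun x := ⟨((a, ⟨rr c x.1.2 • (c - (2⁻¹ : ℝ) • x.1.2), rr_sub _ _⟩),
      (a + x.1.1, ⟨rr c x.1.2 • (c + (2⁻¹ : ℝ) • x.1.2), rr_add _ _⟩)), by
    intro m e
    rw [Prod.ext_iff] at e
    obtain ⟨e1, e2⟩ := e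
    simp only at e1 e2
    have h0 := sub_eq_zero.2 (congrArg Subtype.val e2)
    simp only [psi_diff] at h0
    have h0 := (smul_eq_zero.1 h0).resolve_left (rr_pos _ _).ne'
    exact x.2 m (Prod.ext (by simp only; linarith) h0)⟩
  continuous_toFun := by
    have := rr_cont c
    fun_prop

lemma ball_line (x y : Dball (n - 1)) (t : I) :
    ‖(1 - (t : ℝ)) • x.1 + (t : ℝ) • y.1‖ ≤ 1 := by
  have h0 : 0 ≤ (t : ℝ) := t.2.1
  have h1 : (t : ℝ) ≤ 1 := t.2.2
  refine (norm_add_le _ _).trans ?_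
  rw [norm_smul, norm_smul, Real.norm_of_nonneg h0, Real.norm_of_nonneg (sub_nonneg.2 h1)]
  nlinarith [x.2, y.2]

/-- straight line in the disc -/
def bl (t : I) (x y : Dball (n - 1)) : Dball (n - 1) := ⟨_, ball_line x y t⟩

lemma bl_zero (x y : Dball (n - 1)) : bl 0 x y = x := Subtype.ext (by simp [bl])
lemma bl_one (x y : Dball (n - 1)) : bl 1 x y = y := Subtype.ext (by simp [bl])
lemma bl_self (t : I) (x : Dball (n - 1)) : bl t x x = x :=
  Subtype.ext (by simp only [bl]; module)

lemma bl_cont : Continuous (fun p : I × Dball (n - 1) × Dball (n - 1) => bl p.1 p.2.1 p.2.2) := by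
  unfold bl; fun_prop

lemma line_pos {r : ℝ} (hr : 0 < r) (t : I) : 0 < (1 - (t : ℝ)) * r + t := by
  have h0 : 0 ≤ (t : ℝ) := t.2.1
  have h1 : (t : ℝ) ≤ 1 := t.2.2
  rcases h0.eq_or_lt with h | h
  · rw [← h]; linarith
  · nlinarith

lemma psi_phi_fix (y : UnivCoverConf2 n) :
    PsiC y.1.1.1 ((2⁻¹ : ℝ) • (y.1.1.2.1 + y.1.2.2.1)) (PhiC y) = y := by
  have e1 : (2⁻¹ : ℝ) • (y.1.1.2.1 + y.1.2.2.1) - (2⁻¹ : ℝ) • (y.1.2.2.1 - y.1.1.2.1) = y.1.1.2.1 := by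
    module
  have e2 : (2⁻¹ : ℝ) • (y.1.1.2.1 + y.1.2.2.1) + (2⁻¹ : ℝ) • (y.1.2.2.1 - y.1.1.2.1) = y.1.2.2.1 := by
    module
  have e3 := rr_one ((2⁻¹ : ℝ) • (y.1.1.2.1 + y.1.2.2.1)) (y.1.2.2.1 - y.1.1.2.1)
    (by rw [e1]; exact y.1.1.2.2) (by rw [e2]; exact y.1.2.2.2)
  refine Subtype.ext (Prod.ext (Prod.ext rfl (Subtype.ext ?_)) (Prod.ext ?_ (Subtype.ext ?_)))
  · simp only [PsiC, PhiC, ContinuousMap.coe_mk]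
    rw [e3, one_smul, e1]
  · simp [PsiC, PhiC]
  · simp only [PsiC, PhiC, ContinuousMap.coe_mk]
    rw [e3, one_smul, e2]

/-- the homotopy on the configuration space -/
def confLine (a : ℝ) (c : EuclideanSpace ℝ (Fin (n - 1))) (t : I) (q : UnivCoverConf2 n) : UnivCoverConf2 n :=
  ⟨(((1 - (t : ℝ)) * (PsiC a c (PhiC q)).1.1.1 + t * q.1.1.1, bl t (PsiC a c (PhiC q)).1.1.2 q.1.1.2),
    ((1 - (t : ℝ)) * (PsiC a c (PhiC q)).1.2.1 + t * q.1.2.1, bl t (PsiC a c (PhiC q)).1.2.2 q.1.2.2)), by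
    refine conf_of q.2 (line_pos (rr_pos c (q.1.2.2.1 - q.1.1.2.1)) t) ?_ ?_
    · simp only [PsiC, PhiC, ContinuousMap.coe_mk]
      ring
    · simp only [PsiC, PhiC, ContinuousMap.coe_mk, bl]
      module⟩

lemma confLine_cont (a : ℝ) (c : EuclideanSpace ℝ (Fin (n - 1))) :
    Continuous (fun p : I × UnivCoverConf2 n => confLine a c p.1 p.2) := by
  have h : Continuous (fun p : I × UnivCoverConf2 n => PsiC a c (PhiC p.2)) := by fun_prop
  have hrr := rr_cont c
  unfold confLine
  refine Continuous.subtype_mk ?_ _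
  refine (Continuous.prodMk ?_ ?_).prodMk (Continuous.prodMk ?_ ?_)
  · fun_prop
  · exact bl_cont.comp (f := fun p : I × UnivCoverConf2 n =>
      (p.1, (PsiC a c (PhiC p.2)).1.1.2, p.2.1.1.2)) (by fun_prop)
  · fun_prop
  · exact bl_cont.comp (f := fun p : I × UnivCoverConf2 n =>
      (p.1, (PsiC a c (PhiC p.2)).1.2.2, p.2.1.2.2)) (by fun_prop)

lemma conf_h1 (a : ℝ) (c : EuclideanSpace ℝ (Fin (n - 1))) (y : UnivCoverConf2 n) (hy : PsiC a c (PhiC y) = y) :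
    ((PsiC a c).comp PhiC).HomotopicRel (ContinuousMap.id (UnivCoverConf2 n)) {y} := by
  refine ⟨⟨⟨⟨fun p => confLine a c p.1 p.2, confLine_cont a c⟩, ?_, ?_⟩, ?_⟩⟩
  · intro q
    refine Subtype.ext (Prod.ext (Prod.ext ?_ ?_) (Prod.ext ?_ ?_)) <;> simp [confLine, bl_zero]
  · intro q
    refine Subtype.ext (Prod.ext (Prod.ext ?_ ?_) (Prod.ext ?_ ?_)) <;> simp [confLine, bl_one]
  · rintro t q rfl
    change confLine a c t q = PsiC a c (PhiC q)
    unfold confLine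
    simp only [hy, bl_self]
    refine Subtype.ext (Prod.ext (Prod.ext ?_ rfl) (Prod.ext ?_ rfl)) <;> simp only <;> ring

/-- the homotopy on the complement -/
def xlLine (c : EuclideanSpace ℝ (Fin (n - 1))) (t : I) (x : XL (n - 1)) : XL (n - 1) :=
  ⟨(x.1.1, ((1 - (t : ℝ)) * rr c x.1.2 + t) • x.1.2), by
    intro m e
    rw [Prod.ext_iff] at e
    exact x.2 m (Prod.ext e.1 ((smul_eq_zero.1 e.2).resolve_left (line_pos (rr_pos _ _) t).ne'))⟩

lemma xlLine_cont (c : EuclideanSpace ℝ (Fin (n - 1))) : Continuous (fun p : I × XL (n - 1) => xlLine c p.1 p.2) := by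
  have := rr_cont c
  unfold xlLine
  fun_prop

lemma phi_psi (a : ℝ) (c : EuclideanSpace ℝ (Fin (n - 1))) (x : XL (n - 1)) :
    (PhiC (PsiC a c x)).1 = (x.1.1, rr c x.1.2 • x.1.2) := by
  refine Prod.ext ?_ ?_
  · simp [PhiC, PsiC]
  · simp only [PhiC, PsiC, ContinuousMap.coe_mk, psi_diff]

lemma conf_h2 (a : ℝ) (c : EuclideanSpace ℝ (Fin (n - 1))) (x : XL (n - 1)) (hx : PhiC (PsiC a c x) = x) :
    (PhiC.comp (PsiC a c)).HomotopicRel (ContinuousMap.id (XL (n - 1))) {x} := by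
  refine ⟨⟨⟨⟨fun p => xlLine c p.1 p.2, xlLine_cont c⟩, ?_, ?_⟩, ?_⟩⟩
  · intro q
    refine Subtype.ext ?_
    change _ = (PhiC (PsiC a c q)).1
    rw [phi_psi]
    simp [xlLine]
  · intro q
    refine Subtype.ext ?_
    simp [xlLine]
  · rintro t q rfl
    change xlLine c t q = PhiC (PsiC a c q)
    have h : rr c q.1.2 • q.1.2 = q.1.2 := by
      have := congrArg Subtype.val hx
      rw [phi_psi] at this
      exact congrArg Prod.snd this
    rw [hx]
    refine Subtype.ext (Prod.ext rfl ?_)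
    simp only [xlLine, add_smul, mul_smul, h]
    module

lemma conf_pi [Nonempty (Fin (n - 1))] (hn : 4 ≤ n) (y : UnivCoverConf2 n) :
    Nonempty (HomotopyGroup (Fin (n - 1)) (UnivCoverConf2 n) y ≃* Multiplicative (ℕ →₀ ℤ)) := by
  have hy := psi_phi_fix y
  obtain ⟨e⟩ := XL_pi (by omega) (PhiC y)
  exact ⟨(pi_equiv PhiC _ rfl hy (conf_h1 _ _ y hy) (conf_h2 _ _ (PhiC y) (by rw [hy]))).trans e⟩

lemma conf_sc (hn : 4 ≤ n) : SimplyConnectedSpace (UnivCoverConf2 n) := by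
  have := XL_sc (k := n - 1) (by omega)
  let x : XL (n - 1) := ⟨(1 / 2, 0), by
    intro m e
    have e1 : (1 / 2 : ℝ) = m := congrArg Prod.fst e
    have e2 : (1 : ℝ) = 2 * m := by linarith
    have : (1 : ℤ) = 2 * m := by exact_mod_cast e2
    omega⟩
  let y : UnivCoverConf2 n := PsiC 0 0 x
  have hy := psi_phi_fix y
  have h1 := (conf_h1 _ _ y hy)
  have h2 := (conf_h2 _ _ (PhiC y) (by rw [hy]))
  exact ContinuousMap.HomotopyEquiv.simplyConnectedSpace
    (Y := XL (n - 1)) ⟨PhiC, _, h1.homotopic, h2.homotopic⟩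

end Conf

end

end UC

/-- For every `n ≥ 4`, the universal cover `Ỹ` of `C₂(S¹ × D^{n-1})` is simply connected
and its homotopy group `π_{n-1}`, at any basepoint, is a free abelian group of countably
infinite rank, i.e. isomorphic to `⊕_ℕ ℤ`. -/
theorem univCover_conf2_simplyConnected_and_pi (n : ℕ) (hn : 4 ≤ n) :
    SimplyConnectedSpace (UnivCoverConf2 n) ∧
    ∀ y : UnivCoverConf2 n,
      haveI : Nonempty (Fin (n - 1)) := ⟨⟨0, by omega⟩⟩
      Nonempty (HomotopyGroup (Fin (n - 1)) (UnivCoverConf2 n) y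
        ≃* Multiplicative (ℕ →₀ ℤ)) := by
  exact ⟨UC.conf_sc hn, fun y => by
    have : Nonempty (Fin (n - 1)) := ⟨⟨0, by omega⟩⟩
    exact UC.conf_pi hn y⟩
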